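/- arXiv:1210.0196 — 7 statements merged into one kernel-verified Lean document; each statement's English description precedes it below -/
import Mathlib

section
/- Let (F, C) be a cotorsion pair in an abelian category A with enough injectives. Consider the conditions: (1) F is closed under kernels of epimorphisms between objects of F; (2) F is syzygy closed, i.e. if 0 → X → P → Z → 0 is a short exact sequence with P projective and Z ∈ F then X ∈ F; (3) C is closed under cokernels of monomorphisms between objects of C; (4) C is cosyzygy closed, i.e. if 0 → X → I → Z → 0 is a short exact sequence with I injective and X ∈ C then Z ∈ C; (5) Ext²(F, C) = 0 for all F ∈ F and C ∈ C. Then (3) implies (4), (4) implies (5), (5) implies (1), and (1) implies (2). -/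
open CategoryTheory CategoryTheory.Limits

universe w v u

variable {A : Type u} [Category.{v} A] [Abelian A]

/-- `IsShortExact i p` asserts that `0 → X → Y → Z → 0` is a short exact sequence. -/
def IsShortExact {X Y Z : A} (i : X ⟶ Y) (p : Y ⟶ Z) : Prop :=
  ∃ w : i ≫ p = 0, (ShortComplex.mk i p w).ShortExact

section Ext

variable [HasExt.{w} A]

/-- `Ext¹(X, Y) = 0`. -/
def Ext1Zero (X Y : A) : Prop := Subsingleton (Abelian.Ext X Y 1)

/-- `(F, C)` is a cotorsion pair: each class is the `Ext¹`-orthogonal of the other. -/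
def IsCotorsionPair (F C : Set A) : Prop :=
  (∀ X : A, X ∈ F ↔ ∀ Y ∈ C, Ext1Zero.{w} X Y) ∧
  (∀ Y : A, Y ∈ C ↔ ∀ X ∈ F, Ext1Zero.{w} X Y)

/-- A complete cotorsion pair: for every object `X` there are short exact sequences
`0 → C → F → X → 0` and `0 → X → C' → F' → 0` with `F, F'` in the left class and
`C, C'` in the right class. -/
def IsCompleteCotorsionPair (F C : Set A) : Prop :=
  IsCotorsionPair.{w} F C ∧
  (∀ X : A, ∃ (Co Fo : A) (i : Co ⟶ Fo) (p : Fo ⟶ X),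
    Co ∈ C ∧ Fo ∈ F ∧ IsShortExact i p) ∧
  (∀ X : A, ∃ (Co Fo : A) (i : X ⟶ Co) (p : Co ⟶ Fo),
    Co ∈ C ∧ Fo ∈ F ∧ IsShortExact i p)

end Ext

/-- A thick class: closed under direct summands (retracts) and satisfying two-out-of-three
for short exact sequences. -/
def IsThickClass (W : Set A) : Prop :=
  (∀ (X Y : A) (s : Y ⟶ X) (r : X ⟶ Y), s ≫ r = 𝟙 Y → X ∈ W → Y ∈ W) ∧
  (∀ ⦃X Y Z : A⦄ (i : X ⟶ Y) (p : Y ⟶ Z), IsShortExact i p →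
    (X ∈ W → Y ∈ W → Z ∈ W) ∧ (X ∈ W → Z ∈ W → Y ∈ W) ∧ (Y ∈ W → Z ∈ W → X ∈ W))

/-- The class `F` is closed under kernels of epimorphisms between objects of `F`. -/
def ClosedUnderKernelsOfEpis (F : Set A) : Prop :=
  ∀ ⦃X Y Z : A⦄ (i : X ⟶ Y) (p : Y ⟶ Z), IsShortExact i p → Y ∈ F → Z ∈ F → X ∈ F

/-- The class `C` is closed under cokernels of monomorphisms between objects of `C`. -/
def ClosedUnderCokernelsOfMonos (C : Set A) : Prop :=
  ∀ ⦃X Y Z : A⦄ (i : X ⟶ Y) (p : Y ⟶ Z), IsShortExact i p → X ∈ C → Y ∈ C → Z ∈ C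

/-- An injective cotorsion pair: a complete cotorsion pair `(W, F)` with `W` thick and
`W ∩ F` equal to the class of injective objects. -/
def IsInjectiveCotorsionPair [HasExt.{w} A] (W F : Set A) : Prop :=
  IsCompleteCotorsionPair.{w} W F ∧ IsThickClass W ∧
  ∀ X : A, (X ∈ W ∧ X ∈ F) ↔ Injective X

/-- A projective cotorsion pair: a complete cotorsion pair `(C, W)` with `W` thick and
`C ∩ W` equal to the class of projective objects. -/
def IsProjectiveCotorsionPair [HasExt.{w} A] (C W : Set A) : Prop :=
  IsCompleteCotorsionPair.{w} C W ∧ IsThickClass W ∧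
  ∀ X : A, (X ∈ C ∧ X ∈ W) ↔ Projective X

/-- A Hovey triple `(Q, W, R)`: `W` is thick and both `(Q, W ∩ R)` and `(Q ∩ W, R)` are
complete cotorsion pairs. -/
def IsHoveyTriple [HasExt.{w} A] (Q W R : Set A) : Prop :=
  IsThickClass W ∧ IsCompleteCotorsionPair.{w} Q (W ∩ R) ∧
    IsCompleteCotorsionPair.{w} (Q ∩ W) R

theorem hereditary_test [EnoughInjectives A] [HasExt.{w} A] (F C : Set A)
    (hFC : IsCotorsionPair.{w} F C) :
    -- (3) implies (4)
    (ClosedUnderCokernelsOfMonos C →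
      (∀ ⦃X I Z : A⦄ (i : X ⟶ I) (p : I ⟶ Z), IsShortExact i p → Injective I →
        X ∈ C → Z ∈ C)) ∧
    -- (4) implies (5)
    ((∀ ⦃X I Z : A⦄ (i : X ⟶ I) (p : I ⟶ Z), IsShortExact i p → Injective I →
        X ∈ C → Z ∈ C) →
      (∀ X ∈ F, ∀ Y ∈ C, Subsingleton (Abelian.Ext X Y 2))) ∧
    -- (5) implies (1)
    ((∀ X ∈ F, ∀ Y ∈ C, Subsingleton (Abelian.Ext X Y 2)) →
      ClosedUnderKernelsOfEpis F) ∧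
    -- (1) implies (2)
    (ClosedUnderKernelsOfEpis F →
      (∀ ⦃X P Z : A⦄ (i : X ⟶ P) (p : P ⟶ Z), IsShortExact i p → Projective P →
        Z ∈ F → X ∈ F)) := by
  obtain ⟨hF, hC⟩ := hFC
  refine ⟨?_, ?_, ?_, ?_⟩
  · intro h X I Z i p hs hI hX
    refine h i p hs hX ((hC I).2 fun W _ => ?_)
    exact ⟨fun a b => by
      rw [Abelian.Ext.eq_zero_of_injective a, Abelian.Ext.eq_zero_of_injective b]⟩
  · intro h X hX Y hY
    let S := ShortComplex.mk _ _ (cokernel.condition (Injective.ι Y))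
    have hS : S.ShortExact :=
      { exact := ShortComplex.exact_of_g_is_cokernel _ (cokernelIsCokernel _) }
    have hZ : S.X₃ ∈ C := h S.f S.g ⟨S.zero, hS⟩ (by dsimp [S]; infer_instance) hY
    have h1 : Subsingleton (Abelian.Ext X S.X₃ 1) := (hF X).1 hX _ hZ
    have key : ∀ a : Abelian.Ext X Y 2, a = 0 := fun a => by
      obtain ⟨b, hb⟩ := Abelian.Ext.covariant_sequence_exact₁ X hS a
        (Abelian.Ext.eq_zero_of_injective (n := 1) (I := Injective.under Y) _)
        (n₀ := 1) rfl
      rw [← hb, Subsingleton.elim b 0, Abelian.Ext.zero_comp]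
    exact ⟨fun a b => by rw [key a, key b]⟩
  · intro h X Y Z i p ⟨w, hS⟩ hY hZ
    refine (hF X).2 fun W hW => ?_
    have h2 : Subsingleton (Abelian.Ext Z W 2) := h Z hZ W hW
    have h1 : Subsingleton (Abelian.Ext Y W 1) := (hF Y).1 hY W hW
    have key : ∀ a : Abelian.Ext X W 1, a = 0 := fun a => by
      obtain ⟨b, hb⟩ := Abelian.Ext.contravariant_sequence_exact₁ hS W a (n₁ := 2) rfl
        (h2.elim _ _)
      rw [← hb, h1.elim b 0, Abelian.Ext.comp_zero]
    exact ⟨fun a b => by rw [key a, key b]⟩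
  · intro h X P Z i p hs hP hZ
    refine h i p hs ((hF P).2 fun W _ => ?_) hZ
    exact ⟨fun a b => by
      rw [Abelian.Ext.eq_zero_of_projective a, Abelian.Ext.eq_zero_of_projective b]⟩
end

section
/- Let (W, F) be a hereditary cotorsion pair in an abelian category A. Suppose that for every F ∈ F there exists a short exact sequence 0 → F' → I → F → 0 where I is injective and F' ∈ F. Then W is a thick class: it is closed under direct summands and whenever two of the three terms of a short exact sequence lie in W, so does the third. -/
open CategoryTheory CategoryTheory.Limits

universe w v u

variable {A : Type u} [Category.{v} A] [Abelian A]

theorem henriks_lemma [HasExt.{w} A] (W F : Set A) (h : IsCotorsionPair.{w} W F)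
    (hres : ClosedUnderKernelsOfEpis W) (hcores : ClosedUnderCokernelsOfMonos F)
    (hF : ∀ Fo ∈ F, ∃ (F' I : A) (i : F' ⟶ I) (p : I ⟶ Fo),
      IsShortExact i p ∧ Injective I ∧ F' ∈ F) :
    IsThickClass W := by
  have key : ∀ X : A, (∀ Y ∈ F, ∀ x : Abelian.Ext.{w} X Y 1, x = 0) → X ∈ W := by
    intro X hX
    refine (h.1 X).2 fun Y hY => ⟨fun a b => ?_⟩
    rw [hX Y hY a, hX Y hY b]
  have key' : ∀ X ∈ W, ∀ Y ∈ F, ∀ x : Abelian.Ext.{w} X Y 1, x = 0 := by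
    intro X hX Y hY x
    have hs : Subsingleton (Abelian.Ext.{w} X Y 1) := (h.1 X).1 hX Y hY
    exact Subsingleton.elim _ _
  refine ⟨?_, ?_⟩
  · intro X Y s r hsr hX
    refine key Y fun Z hZ x => ?_
    have h1 : (Abelian.Ext.mk₀ s).comp ((Abelian.Ext.mk₀ r).comp x (zero_add 1))
        (zero_add 1) = x := by
      rw [Abelian.Ext.mk₀_comp_mk₀_assoc, hsr, Abelian.Ext.mk₀_id_comp]
    rw [← h1, key' X hX Z hZ ((Abelian.Ext.mk₀ r).comp x (zero_add 1)), Abelian.Ext.comp_zero]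
  · intro X Y Z i p hip
    obtain ⟨hw, hS⟩ := id hip
    refine ⟨?_, ?_, fun hY hZ => hres i p hip hY hZ⟩
    · intro hX hY
      refine key Z fun Fo hFo x => ?_
      obtain ⟨F', I, j, q, ⟨hw', hT⟩, hI, hF'⟩ := hF Fo hFo
      have h0 : x.comp hT.extClass (show 1 + 1 = 2 from rfl) = 0 := by
        have h1 : (Abelian.Ext.mk₀ p).comp (x.comp hT.extClass (show 1 + 1 = 2 from rfl))
            (zero_add 2) = 0 := by
          rw [← Abelian.Ext.comp_assoc _ _ _ (zero_add 1) (show 1 + 1 = 2 from rfl) (by lia),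
            key' Y hY Fo hFo ((Abelian.Ext.mk₀ p).comp x (zero_add 1)), Abelian.Ext.zero_comp]
        obtain ⟨y, hy⟩ := Abelian.Ext.contravariant_sequence_exact₃ hS F' _ h1
          (show 1 + 1 = 2 from rfl)
        rw [← hy, key' X hX F' hF' y, Abelian.Ext.comp_zero]
      obtain ⟨y, hy⟩ := Abelian.Ext.covariant_sequence_exact₃ Z hT x (show 1 + 1 = 2 from rfl) h0
      rw [← hy, Abelian.Ext.eq_zero_of_injective y, Abelian.Ext.zero_comp]
    · intro hX hZ
      refine key Y fun Fo hFo x => ?_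
      obtain ⟨y, hy⟩ := Abelian.Ext.contravariant_sequence_exact₂ hS Fo x (key' X hX Fo hFo _)
      rw [← hy, key' Z hZ Fo hFo y, Abelian.Ext.comp_zero]
end

section
/- Let (C, W) be a complete cotorsion pair in an abelian category A with enough projectives. Then the following are equivalent: (1) W is thick and C ∩ W equals the class of projective objects of A; (2) (C, W) is hereditary and C ∩ W equals the class of projective objects of A; (3) W is thick and W contains all projective objects of A. -/
open CategoryTheory CategoryTheory.Limits

universe w v u

variable {A : Type u} [Category.{v} A] [Abelian A]

open Abelian in
theorem pcp_key [HasExt.{w} A] {S T : ShortComplex A} (hS : S.ShortExact) (hT : T.ShortExact)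
    (x : Ext.{w} T.X₁ S.X₁ 1) (hx : x.comp (Ext.mk₀ S.f) (add_zero 1) = 0)
    (h1 : Ext1Zero.{w} T.X₃ S.X₃) (h2 : Ext1Zero.{w} T.X₂ S.X₁) : x = 0 := by
  obtain ⟨y, rfl⟩ := Ext.covariant_sequence_exact₁ _ hS x hx (zero_add 1)
  have h1' : Subsingleton (Ext.{w} T.X₃ S.X₃ 1) := h1
  have h2' : Subsingleton (Ext.{w} T.X₂ S.X₁ 1) := h2
  obtain ⟨z, rfl⟩ := Ext.contravariant_sequence_exact₁ hT _ y (add_zero 1)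
    (Subsingleton.elim _ _)
  rw [Ext.comp_assoc (Ext.mk₀ T.f) z hS.extClass (zero_add 0) (zero_add 1) (by simp),
    Subsingleton.elim (z.comp hS.extClass (zero_add 1)) 0, Ext.comp_zero]

theorem pcp_cokernel {X Y : A} (f : X ⟶ Y) [Mono f] : IsShortExact f (cokernel.π f) :=
  ⟨cokernel.condition f, { exact := ShortComplex.exact_cokernel f }⟩

theorem pcp_kernel {X Y : A} (f : X ⟶ Y) [Epi f] : IsShortExact (kernel.ι f) f :=
  ⟨kernel.condition f, { exact := ShortComplex.exact_kernel f }⟩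

open Abelian in
theorem pcp_left_ext [HasExt.{w} A] {C W : Set A} (h : IsCotorsionPair.{w} C W)
    {X Y Z : A} (i : X ⟶ Y) (p : Y ⟶ Z) (hs : IsShortExact i p) (hX : X ∈ C) (hZ : Z ∈ C) :
    Y ∈ C := by
  obtain ⟨w0, hs⟩ := hs
  refine (h.1 Y).2 fun V hV => subsingleton_of_forall_eq 0 fun x => ?_
  have a : Subsingleton (Ext.{w} X V 1) := (h.1 X).1 hX V hV
  have b : Subsingleton (Ext.{w} Z V 1) := (h.1 Z).1 hZ V hV
  obtain ⟨y, rfl⟩ := Ext.contravariant_sequence_exact₂ hs _ x (Subsingleton.elim (α := Ext.{w} X V 1) _ _)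
  rw [Subsingleton.elim (α := Ext.{w} Z V 1) y 0, Ext.comp_zero]

open Abelian in
theorem pcp_right_ext [HasExt.{w} A] {C W : Set A} (h : IsCotorsionPair.{w} C W)
    {X Y Z : A} (i : X ⟶ Y) (p : Y ⟶ Z) (hs : IsShortExact i p) (hX : X ∈ W) (hZ : Z ∈ W) :
    Y ∈ W := by
  obtain ⟨w0, hs⟩ := hs
  refine (h.2 Y).2 fun V hV => subsingleton_of_forall_eq 0 fun x => ?_
  have a : Subsingleton (Ext.{w} V X 1) := (h.2 X).1 hX V hV
  have b : Subsingleton (Ext.{w} V Z 1) := (h.2 Z).1 hZ V hV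
  obtain ⟨y, rfl⟩ := Ext.covariant_sequence_exact₂ _ hs x (Subsingleton.elim (α := Ext.{w} V Z 1) _ _)
  rw [Subsingleton.elim (α := Ext.{w} V X 1) y 0, Ext.zero_comp]

open Abelian in
theorem pcp_right_retract [HasExt.{w} A] {C W : Set A} (h : IsCotorsionPair.{w} C W)
    (X Y : A) (s : Y ⟶ X) (r : X ⟶ Y) (hsr : s ≫ r = 𝟙 Y) (hX : X ∈ W) : Y ∈ W := by
  refine (h.2 Y).2 fun V hV => subsingleton_of_forall_eq 0 fun x => ?_
  have a : Subsingleton (Ext.{w} V X 1) := (h.2 X).1 hX V hV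
  have e : (x.comp (Ext.mk₀ s) (add_zero 1)).comp (Ext.mk₀ r) (add_zero 1) = x := by
    rw [Ext.comp_assoc_of_third_deg_zero, Ext.mk₀_comp_mk₀, hsr, Ext.comp_mk₀_id]
  rw [← e, Subsingleton.elim (x.comp (Ext.mk₀ s) (add_zero 1)) 0, Ext.zero_comp]

open Abelian in
/-- Cokernel-closedness of the right class gives kernel-closedness of the left class. -/
theorem pcp_kernels [EnoughProjectives A] [HasExt.{w} A] {C W : Set A}
    (h : IsCompleteCotorsionPair.{w} C W) (hW : ClosedUnderCokernelsOfMonos W) :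
    ClosedUnderKernelsOfEpis C := by
  intro X Y Z i p hs hY hZ
  obtain ⟨w0, hs⟩ := hs
  refine (h.1.1 X).2 fun V hV => subsingleton_of_forall_eq 0 fun x => ?_
  -- a projective presentation of `X` and a representative of the class
  obtain ⟨w1, hP⟩ := pcp_kernel (Projective.π X)
  obtain ⟨g0, hg⟩ := Ext.contravariant_sequence_exact₃ hP _ x
    (Ext.eq_zero_of_projective _) (add_zero 1)
  obtain ⟨g, rfl⟩ := Ext.addEquiv₀.symm.surjective g0
  dsimp at g hg
  obtain ⟨E, F, k, q, hE, hF, w2, hk⟩ := h.2.2 (pushout (kernel.ι (Projective.π X)) g)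
  have : Mono k := hk.mono_f
  let j : V ⟶ E := pushout.inr (kernel.ι (Projective.π X)) g ≫ k
  have hj : IsShortExact j (cokernel.π j) := pcp_cokernel j
  have hQ := hW _ _ hj hV hE
  obtain ⟨w3, hj⟩ := hj
  refine pcp_key hj hs x ?_ ((h.1.1 Z).1 hZ _ hQ) ((h.1.1 Y).1 hY _ hV)
  rw [← hg]
  have e : g ≫ j = kernel.ι (Projective.π X) ≫ pushout.inl (kernel.ι (Projective.π X)) g ≫ k := by
    simp only [j, ← Category.assoc, pushout.condition]
  change (hP.extClass.comp (Ext.mk₀ g) (add_zero 1)).comp (Ext.mk₀ j) (add_zero 1) = 0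
  rw [Ext.comp_assoc_of_third_deg_zero, Ext.mk₀_comp_mk₀, e, ← Ext.mk₀_comp_mk₀]
  exact hP.extClass_comp_assoc _

open Abelian in
theorem pcp_thick [HasExt.{w} A] {C W : Set A}
    (h : IsCompleteCotorsionPair.{w} C W) (hW : ClosedUnderCokernelsOfMonos W)
    (hp : ∀ X : A, (X ∈ C ∧ X ∈ W) ↔ Projective X) : IsThickClass W := by
  refine ⟨pcp_right_retract h.1, fun X Y Z i p hs => ⟨hW i p hs, pcp_right_ext h.1 i p hs, ?_⟩⟩
  intro hY hZ
  obtain ⟨w0, hs⟩ := hs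
  refine (h.1.2 X).2 fun V hV => subsingleton_of_forall_eq 0 fun x => ?_
  obtain ⟨P, F, k, q, hPW, hF, hk⟩ := h.2.2 V
  have hP : Projective P := (hp P).1 ⟨pcp_left_ext h.1 k q hk hV hF, hPW⟩
  obtain ⟨w1, hk⟩ := hk
  have a : Subsingleton (Ext.{w} V Y 1) := (h.1.2 Y).1 hY V hV
  exact pcp_key hs hk x (Subsingleton.elim (α := Ext.{w} V Y 1) _ _) ((h.1.2 Z).1 hZ F hF)
    (subsingleton_of_forall_eq 0 fun y => Ext.eq_zero_of_projective y)

open Abelian in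
theorem pcp_proj [EnoughProjectives A] [HasExt.{w} A] {C W : Set A}
    (h : IsCompleteCotorsionPair.{w} C W) (hW : IsThickClass W)
    (hp : ∀ X : A, Projective X → X ∈ W) (X : A) : (X ∈ C ∧ X ∈ W) ↔ Projective X := by
  constructor
  · rintro ⟨hC, hX⟩
    have hs := pcp_kernel (Projective.π X)
    have hK := (hW.2 _ _ hs).2.2 (hp _ inferInstance) hX
    obtain ⟨w0, hs⟩ := hs
    have a : Subsingleton (Ext.{w} X (kernel (Projective.π X)) 1) := (h.1.1 X).1 hC _ hK
    obtain ⟨y, hy⟩ := Ext.covariant_sequence_exact₃ X hs (Ext.mk₀ (𝟙 X)) (zero_add 1)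
      (Subsingleton.elim (α := Ext.{w} X (kernel (Projective.π X)) 1) _ _)
    obtain ⟨s, rfl⟩ := Ext.addEquiv₀.symm.surjective y
    change (Ext.mk₀ s).comp (Ext.mk₀ (Projective.π X)) (zero_add 0) = _ at hy
    rw [Ext.mk₀_comp_mk₀] at hy
    have hy' := Ext.addEquiv₀.symm.injective hy
    exact Retract.projective (Y := Projective.over X) ⟨s, Projective.π X, hy'⟩
  · intro hX
    exact ⟨(h.1.1 X).2 fun V _ => subsingleton_of_forall_eq 0 fun y =>
      Ext.eq_zero_of_projective y, hp X hX⟩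

theorem projective_cotorsion_pair_characterizations [EnoughProjectives A] [HasExt.{w} A]
    (C W : Set A) (h : IsCompleteCotorsionPair.{w} C W) :
    ((IsThickClass W ∧ ∀ X : A, (X ∈ C ∧ X ∈ W) ↔ Projective X) ↔
      ((ClosedUnderKernelsOfEpis C ∧ ClosedUnderCokernelsOfMonos W) ∧
        ∀ X : A, (X ∈ C ∧ X ∈ W) ↔ Projective X)) ∧
    ((IsThickClass W ∧ ∀ X : A, (X ∈ C ∧ X ∈ W) ↔ Projective X) ↔
      (IsThickClass W ∧ ∀ X : A, Projective X → X ∈ W)) := by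
  refine ⟨⟨fun ⟨hW, hp⟩ => ?_, fun ⟨⟨_, hW⟩, hp⟩ => ⟨pcp_thick h hW hp, hp⟩⟩,
    ⟨fun ⟨hW, hp⟩ => ⟨hW, fun X hX => ((hp X).2 hX).2⟩,
      fun ⟨hW, hp⟩ => ⟨hW, pcp_proj h hW hp⟩⟩⟩
  have hc : ClosedUnderCokernelsOfMonos W := fun X Y Z i p hs => (hW.2 i p hs).1
  exact ⟨⟨pcp_kernels h hc, hc⟩, hp⟩
end

section
/- Let A be an abelian category with enough injectives and let (W₁, F₁) and (W₂, F₂) be injective cotorsion pairs with F₂ ⊆ F₁. Define W = {X ∈ A | there is a short exact sequence 0 → X → F → W → 0 with F ∈ F₂ and W ∈ W₁}. Then W also equals {X ∈ A | there is a short exact sequence 0 → F → W → X → 0 with F ∈ F₂ and W ∈ W₁}, W is thick, (W₂, W, F₁) is a Hovey triple, and W₂ ∩ W ∩ F₁ equals the class of injective objects of A. -/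
open CategoryTheory CategoryTheory.Limits

universe w v u

variable {A : Type u} [Category.{v} A] [Abelian A]

/-- The Becker localization class: objects `X` admitting a short exact sequence
`0 → X → F → W → 0` with `F ∈ F₂` and `W ∈ W₁`. -/
def beckerClass (F₂ W₁ : Set A) : Set A :=
  {X : A | ∃ (Fo Wo : A) (i : X ⟶ Fo) (p : Fo ⟶ Wo), IsShortExact i p ∧ Fo ∈ F₂ ∧ Wo ∈ W₁}

lemma ses_mono {X Y Z : A} {i : X ⟶ Y} {p : Y ⟶ Z} (h : IsShortExact i p) : Mono i := by
  obtain ⟨w, h⟩ := h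
  exact h.mono_f

lemma ses_epi {X Y Z : A} {i : X ⟶ Y} {p : Y ⟶ Z} (h : IsShortExact i p) : Epi p := by
  obtain ⟨w, h⟩ := h
  exact h.epi_g

lemma ses_w {X Y Z : A} {i : X ⟶ Y} {p : Y ⟶ Z} (h : IsShortExact i p) : i ≫ p = 0 := h.1

lemma ses_lift {X Y Z : A} {i : X ⟶ Y} {p : Y ⟶ Z} (h : IsShortExact i p)
    {T : A} (x : T ⟶ Y) (hx : x ≫ p = 0) : ∃ y : T ⟶ X, y ≫ i = x := by
  obtain ⟨w, h⟩ := h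
  have := h.mono_f
  exact ⟨h.exact.lift x hx, h.exact.lift_f x hx⟩

lemma ses_desc {X Y Z : A} {i : X ⟶ Y} {p : Y ⟶ Z} (h : IsShortExact i p)
    {T : A} (x : Y ⟶ T) (hx : i ≫ x = 0) : ∃ y : Z ⟶ T, p ≫ y = x := by
  obtain ⟨w, h⟩ := h
  have := h.epi_g
  exact ⟨h.exact.desc x hx, h.exact.g_desc x hx⟩

lemma ses_mk_desc {X Y Z : A} {i : X ⟶ Y} {p : Y ⟶ Z} (hi : Mono i) (hp : Epi p)
    (w : i ≫ p = 0) (h : ∀ (T : A) (x : Y ⟶ T), i ≫ x = 0 → ∃ y : Z ⟶ T, p ≫ y = x) :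
    IsShortExact i p := by
  refine ⟨w, ?_⟩
  have hc : IsColimit (CokernelCofork.ofπ p w) :=
    CokernelCofork.IsColimit.ofπ' p w (fun {T} k hk => ⟨(h T k hk).choose, (h T k hk).choose_spec⟩)
  exact { exact := ShortComplex.exact_of_g_is_cokernel _ hc, mono_f := hi, epi_g := hp }

lemma ses_mk_lift {X Y Z : A} {i : X ⟶ Y} {p : Y ⟶ Z} (hi : Mono i) (hp : Epi p)
    (w : i ≫ p = 0) (h : ∀ (T : A) (x : T ⟶ Y), x ≫ p = 0 → ∃ y : T ⟶ X, y ≫ i = x) :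
    IsShortExact i p := by
  refine ⟨w, ?_⟩
  have hc : IsLimit (KernelFork.ofι i w) :=
    KernelFork.IsLimit.ofι' i w (fun {T} k hk => ⟨(h T k hk).choose, (h T k hk).choose_spec⟩)
  exact { exact := ShortComplex.exact_of_f_is_kernel _ hc, mono_f := hi, epi_g := hp }

lemma ses_cokernel {X Y : A} (i : X ⟶ Y) [hi : Mono i] : IsShortExact i (cokernel.π i) :=
  ses_mk_desc hi inferInstance (cokernel.condition i)
    (fun _ x hx => ⟨cokernel.desc i x hx, cokernel.π_desc i x hx⟩)

lemma ses_kernel {X Y : A} (p : X ⟶ Y) [hp : Epi p] : IsShortExact (kernel.ι p) p :=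
  ses_mk_lift inferInstance hp (kernel.condition p)
    (fun _ x hx => ⟨kernel.lift p x hx, kernel.lift_ι p x hx⟩)

lemma ses_id_zero (X : A) {O : A} (hO : IsZero O) : IsShortExact (𝟙 X) (0 : X ⟶ O) :=
  ses_mk_lift inferInstance ⟨fun _ _ _ => hO.eq_of_src _ _⟩ (by simp)
    (fun _ x _ => ⟨x, by simp⟩)

/-- Pushout of a short exact sequence. -/
lemma ses_pushout {X Y Z X' : A} {i : X ⟶ Y} {p : Y ⟶ Z} (h : IsShortExact i p) (f : X ⟶ X') :
    ∃ (P : A) (g : Y ⟶ P) (i' : X' ⟶ P) (p' : P ⟶ Z), IsShortExact i' p' ∧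
      (∀ (V : A) (q : X' ⟶ V), IsShortExact f q → ∃ q' : P ⟶ V, IsShortExact g q') ∧
      (∀ (K : A) (k : K ⟶ X), IsShortExact k f → IsShortExact (k ≫ i) g) := by
  have := ses_mono h
  have := ses_epi h
  refine ⟨pushout i f, pushout.inl i f, pushout.inr i f,
    pushout.desc p 0 (by simp [ses_w h]), ?_, ?_, ?_⟩
  · refine ses_mk_desc inferInstance ?_ (by simp only [pushout.inl_desc, pushout.inr_desc]) ?_
    · have : Epi (pushout.inl i f ≫ pushout.desc p (0 : X' ⟶ Z) (by simp [ses_w h])) := by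
        simpa only [pushout.inl_desc, pushout.inr_desc, pullback.lift_fst, pullback.lift_snd]
      exact epi_of_epi (pushout.inl i f) _
    · intro T x hx
      obtain ⟨y, hy⟩ := ses_desc h (pushout.inl i f ≫ x) (by
        rw [← Category.assoc, pushout.condition, Category.assoc, hx, comp_zero])
      exact ⟨y, by apply pushout.hom_ext <;> simp [hy, hx, pushout.inl_desc_assoc, pushout.inr_desc_assoc]⟩
  · intro V q hq
    have := ses_mono hq
    have := ses_epi hq
    refine ⟨pushout.desc 0 q (by simp [ses_w hq]), ses_mk_desc inferInstance ?_ (by simp only [pushout.inl_desc, pushout.inr_desc]) ?_⟩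
    · have : Epi (pushout.inr i f ≫ pushout.desc (0 : Y ⟶ V) q (by simp [ses_w hq])) := by
        simpa only [pushout.inl_desc, pushout.inr_desc, pullback.lift_fst, pullback.lift_snd]
      exact epi_of_epi (pushout.inr i f) _
    · intro T x hx
      obtain ⟨y, hy⟩ := ses_desc hq (pushout.inr i f ≫ x) (by
        rw [← Category.assoc, ← pushout.condition, Category.assoc, hx, comp_zero])
      exact ⟨y, by apply pushout.hom_ext <;> simp [hy, hx, pushout.inl_desc_assoc, pushout.inr_desc_assoc]⟩
  · intro K k hk
    have := ses_mono hk
    have := ses_epi hk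
    refine ses_mk_desc (mono_comp _ _) inferInstance ?_ ?_
    · rw [Category.assoc, pushout.condition, ← Category.assoc, ses_w hk, zero_comp]
    · intro T x hx
      obtain ⟨y, hy⟩ := ses_desc hk (i ≫ x) (by rw [← Category.assoc, hx])
      exact ⟨pushout.desc x y hy.symm, pushout.inl_desc _ _ _⟩

/-- Pullback of two short exact sequences with the same end term. -/
lemma ses_pullback {X Y Z K J : A} {i : X ⟶ Y} {p : Y ⟶ Z} (h : IsShortExact i p)
    {k : K ⟶ J} {q : J ⟶ Z} (h' : IsShortExact k q) :
    ∃ (P : A) (a : K ⟶ P) (b : X ⟶ P) (c : P ⟶ Y) (d : P ⟶ J),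
      IsShortExact a c ∧ IsShortExact b d ∧ c ≫ p = d ≫ q := by
  have := ses_mono h
  have := ses_epi h
  have := ses_mono h'
  have := ses_epi h'
  refine ⟨pullback p q, pullback.lift 0 k (by simp [ses_w h']), pullback.lift i 0 (by simp [ses_w h]),
    pullback.fst p q, pullback.snd p q, ?_, ?_, pullback.condition⟩
  · refine ses_mk_lift ?_ inferInstance (by simp only [pullback.lift_fst, pullback.lift_snd]) ?_
    · have : Mono (pullback.lift (0 : K ⟶ Y) k (by simp [ses_w h']) ≫ pullback.snd p q) := by
        simpa only [pushout.inl_desc, pushout.inr_desc, pullback.lift_fst, pullback.lift_snd]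
      exact mono_of_mono _ (pullback.snd p q)
    · intro T x hx
      obtain ⟨y, hy⟩ := ses_lift h' (x ≫ pullback.snd p q) (by
        rw [Category.assoc, ← pullback.condition, ← Category.assoc, hx, zero_comp])
      exact ⟨y, by apply pullback.hom_ext <;> simp [hy, hx, pullback.lift_fst, pullback.lift_snd]⟩
  · refine ses_mk_lift ?_ inferInstance (by simp only [pullback.lift_fst, pullback.lift_snd]) ?_
    · have : Mono (pullback.lift i (0 : X ⟶ J) (by simp [ses_w h]) ≫ pullback.fst p q) := by
        simpa only [pushout.inl_desc, pushout.inr_desc, pullback.lift_fst, pullback.lift_snd]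
      exact mono_of_mono _ (pullback.fst p q)
    · intro T x hx
      obtain ⟨y, hy⟩ := ses_lift h (x ≫ pullback.fst p q) (by
        rw [Category.assoc, pullback.condition, ← Category.assoc, hx, zero_comp])
      exact ⟨y, by apply pullback.hom_ext <;> simp [hy, hx, pullback.lift_fst, pullback.lift_snd]⟩

section ExtLemmas

open CategoryTheory.Abelian

variable [HasExt.{w} A]

lemma ext1_ext {Q X Y Z : A} {i : X ⟶ Y} {p : Y ⟶ Z} (h : IsShortExact i p)
    (hX : Ext1Zero.{w} Q X) (hZ : Ext1Zero.{w} Q Z) : Ext1Zero.{w} Q Y := by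
  obtain ⟨w, h⟩ := h
  refine subsingleton_of_forall_eq 0 (fun e => ?_)
  obtain ⟨x, hx⟩ := Ext.covariant_sequence_exact₂ Q h e (hZ.elim _ _)
  rw [← hx, hX.elim x 0, Ext.zero_comp]

lemma ext1_lift {Q X Y Z : A} {i : X ⟶ Y} {p : Y ⟶ Z} (h : IsShortExact i p)
    (hX : Ext1Zero.{w} Q X) (f : Q ⟶ Z) : ∃ g : Q ⟶ Y, g ≫ p = f := by
  obtain ⟨w, h⟩ := h
  obtain ⟨x, hx⟩ := Ext.covariant_sequence_exact₃ Q h (Ext.mk₀ f) (zero_add 1) (hX.elim _ _)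
  obtain ⟨g, rfl⟩ := (Ext.mk₀_bijective Q Y).2 x
  refine ⟨g, (Ext.mk₀_bijective Q Z).1 ?_⟩
  rw [← hx, Ext.mk₀_comp_mk₀]

lemma ext1_extend {Q X Y Z : A} {i : X ⟶ Y} {p : Y ⟶ Z} (h : IsShortExact i p)
    (hZ : Ext1Zero.{w} Z Q) (f : X ⟶ Q) : ∃ g : Y ⟶ Q, i ≫ g = f := by
  obtain ⟨w, h⟩ := h
  obtain ⟨x, hx⟩ := Ext.contravariant_sequence_exact₁ h Q (Ext.mk₀ f) (add_zero 1) (hZ.elim _ _)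
  obtain ⟨g, rfl⟩ := (Ext.mk₀_bijective Y Q).2 x
  refine ⟨g, (Ext.mk₀_bijective X Q).1 ?_⟩
  rw [← hx, Ext.mk₀_comp_mk₀]

lemma ext1_inj (Q I : A) [Injective I] : Ext1Zero.{w} Q I :=
  subsingleton_of_forall_eq 0 (fun e => e.eq_zero_of_injective)

/-- If the identity of `Y` is a sum of two maps factoring through `Ext¹(Q,-)`-acyclic objects. -/
lemma ext1_factor {Q Y U V : A} (a : Y ⟶ U) (b : U ⟶ Y) (c : Y ⟶ V) (d : V ⟶ Y)
    (h : a ≫ b + c ≫ d = 𝟙 Y) (hU : Ext1Zero.{w} Q U) (hV : Ext1Zero.{w} Q V) :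
    Ext1Zero.{w} Q Y := by
  refine subsingleton_of_forall_eq 0 (fun e => ?_)
  have h1 : (e.comp (Ext.mk₀ a) (add_zero 1)).comp (Ext.mk₀ b) (add_zero 1) = 0 := by
    rw [hU.elim (e.comp (Ext.mk₀ a) (add_zero 1)) 0, Ext.zero_comp]
  have h2 : (e.comp (Ext.mk₀ c) (add_zero 1)).comp (Ext.mk₀ d) (add_zero 1) = 0 := by
    rw [hV.elim (e.comp (Ext.mk₀ c) (add_zero 1)) 0, Ext.zero_comp]
  rw [Ext.comp_assoc_of_third_deg_zero, Ext.mk₀_comp_mk₀] at h1 h2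
  rw [← e.comp_mk₀_id, ← h, Ext.mk₀_add, Ext.comp_add, h1, h2, add_zero]

/-- Vanishing criterion using an injective embedding. -/
lemma ext1_of_lift {Q X I Z : A} {i : X ⟶ I} {p : I ⟶ Z} (h : IsShortExact i p) [Injective I]
    (H : ∀ f : Q ⟶ Z, ∃ g : Q ⟶ I, g ≫ p = f) : Ext1Zero.{w} Q X := by
  obtain ⟨w, h⟩ := h
  refine subsingleton_of_forall_eq 0 (fun e => ?_)
  obtain ⟨x, hx⟩ := Ext.covariant_sequence_exact₁ Q h e
    (Ext.eq_zero_of_injective (n := 0) _) (zero_add 1)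
  obtain ⟨f, rfl⟩ := (Ext.mk₀_bijective Q Z).2 x
  obtain ⟨g, rfl⟩ := H f
  rw [← hx, ← Ext.mk₀_comp_mk₀, Ext.comp_assoc (h := rfl) (h₂₃ := zero_add 1)]
  have := h.comp_extClass
  dsimp only at this
  rw [this, Ext.comp_zero]

lemma inj_pair_coker [EnoughInjectives A] {W F : Set A} (h : IsInjectiveCotorsionPair.{w} W F)
    {X Y Z : A} {i : X ⟶ Y} {p : Y ⟶ Z} (hs : IsShortExact i p) (hX : X ∈ F) (hY : Y ∈ F) :
    Z ∈ F := by
  obtain ⟨⟨⟨hl, hr⟩, hc1, hc2⟩, ⟨-, ht⟩, -⟩ := h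
  rw [hr]
  intro Q hQ
  have hj := ses_cokernel (Injective.ι Z)
  refine ext1_of_lift hj (fun f => ?_)
  have := ses_epi hj
  -- cover the pullback
  obtain ⟨K0, V, k0, q0, hK0, hV, hs0⟩ := hc1 (pullback f (cokernel.π (Injective.ι Z)))
  have := ses_epi hs0
  have he : Epi (q0 ≫ pullback.fst f (cokernel.π (Injective.ι Z))) := epi_comp _ _
  have hk := ses_kernel (q0 ≫ pullback.fst f (cokernel.π (Injective.ι Z)))
  set e := q0 ≫ pullback.fst f (cokernel.π (Injective.ι Z)) with he_def
  set m := q0 ≫ pullback.snd f (cokernel.π (Injective.ι Z)) with hm_def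
  have hem : e ≫ f = m ≫ cokernel.π (Injective.ι Z) := by
    simp [he_def, hm_def, pullback.condition]
  have hKW : kernel e ∈ W := (ht _ _ hk).2.2 hV hQ
  obtain ⟨u, hu⟩ := ses_lift hj (kernel.ι e ≫ m) (by
    rw [Category.assoc, ← hem, ← Category.assoc, kernel.condition, zero_comp])
  obtain ⟨u', hu'⟩ := ext1_lift hs ((hr X).1 hX _ hKW) u
  obtain ⟨v, hv⟩ := ext1_extend hk ((hr Y).1 hY _ hQ) u'
  obtain ⟨g, hg⟩ := ses_desc hk (m - v ≫ p ≫ Injective.ι Z) (by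
    rw [Preadditive.comp_sub, ← Category.assoc _ v, hv, ← Category.assoc u', hu', hu, sub_self])
  refine ⟨g, ?_⟩
  rw [← cancel_epi e, ← Category.assoc, hg, Preadditive.sub_comp, hem]
  simp

end ExtLemmas

theorem becker_localization [EnoughInjectives A] [HasExt.{w} A] (W₁ F₁ W₂ F₂ : Set A)
    (h1 : IsInjectiveCotorsionPair.{w} W₁ F₁) (h2 : IsInjectiveCotorsionPair.{w} W₂ F₂)
    (hsub : F₂ ⊆ F₁) :
    beckerClass F₂ W₁ = {X : A | ∃ (Fo Wo : A) (i : Fo ⟶ Wo) (p : Wo ⟶ X),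
        IsShortExact i p ∧ Fo ∈ F₂ ∧ Wo ∈ W₁} ∧
    IsThickClass (beckerClass F₂ W₁) ∧
    IsHoveyTriple.{w} W₂ (beckerClass F₂ W₁) F₁ ∧
    (∀ X : A, (X ∈ W₂ ∧ X ∈ beckerClass F₂ W₁ ∧ X ∈ F₁) ↔ Injective X) := by
  have hcok1 := fun {X Y Z : A} {i : X ⟶ Y} {p : Y ⟶ Z} => inj_pair_coker h1 (i := i) (p := p)
  have hcok2 := fun {X Y Z : A} {i : X ⟶ Y} {p : Y ⟶ Z} => inj_pair_coker h2 (i := i) (p := p)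
  obtain ⟨hcc1, ⟨-, ht1⟩, hinj1⟩ := h1
  obtain ⟨hcc2, ⟨-, ht2⟩, hinj2⟩ := h2
  obtain ⟨⟨hl1, hr1⟩, hp1, he1⟩ := hcc1
  have hcc2' := hcc2
  obtain ⟨⟨hl2, hr2⟩, hp2, he2⟩ := hcc2'
  have hextF1 : ∀ {X Y Z : A} {i : X ⟶ Y} {p : Y ⟶ Z}, IsShortExact i p → X ∈ F₁ → Z ∈ F₁ →
      Y ∈ F₁ := fun h hX hZ => (hr1 _).2 fun Q hQ =>
        ext1_ext h ((hr1 _).1 hX Q hQ) ((hr1 _).1 hZ Q hQ)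
  have hextF2 : ∀ {X Y Z : A} {i : X ⟶ Y} {p : Y ⟶ Z}, IsShortExact i p → X ∈ F₂ → Z ∈ F₂ →
      Y ∈ F₂ := fun h hX hZ => (hr2 _).2 fun Q hQ =>
        ext1_ext h ((hr2 _).1 hX Q hQ) ((hr2 _).1 hZ Q hQ)
  have hW12 : W₁ ⊆ W₂ := fun X hX => (hl2 X).2 fun Y hY => (hl1 X).1 hX Y (hsub hY)
  obtain ⟨O, hO⟩ : ∃ O : A, IsZero O := HasZeroObject.zero
  have hOi : Injective O := ⟨fun _ _ _ => ⟨0, hO.eq_of_tgt _ _⟩⟩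
  have hzero : O ∈ W₁ := ((hinj1 O).2 hOi).1
  -- maps from `W₁` to `F₁` factor through an injective
  have hfac : ∀ {V G : A} (f : V ⟶ G), V ∈ W₁ → G ∈ F₁ →
      ∃ (I : A) (_ : Injective I) (c : V ⟶ I) (d : I ⟶ G), c ≫ d = f := by
    intro V G f hV hG
    obtain ⟨I, V', c, q, hI, hV', hs⟩ := he1 V
    obtain ⟨d, hd⟩ := ext1_extend hs ((hr1 G).1 hG _ hV') f
    exact ⟨I, (hinj1 I).1 ⟨(ht1 _ _ hs).2.1 hV hV', hI⟩, c, d, hd⟩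
  -- key lemma
  have key : ∀ {X Y G V G' V' : A} (s : Y ⟶ X) (r : X ⟶ Y) (i : X ⟶ G) (p : G ⟶ V)
      (i' : Y ⟶ G') (p' : G' ⟶ V'), s ≫ r = 𝟙 Y → IsShortExact i p → G ∈ F₂ → V ∈ W₁ →
      IsShortExact i' p' → G' ∈ F₁ → V' ∈ W₁ → G' ∈ F₂ := by
    intro X Y G V G' V' s r i p i' p' hsr hs hG hV hs' hG' hV'
    obtain ⟨a, ha⟩ := ext1_extend hs' ((hr1 G).1 (hsub hG) _ hV') (s ≫ i)
    obtain ⟨b, hb⟩ := ext1_extend hs ((hr1 G').1 hG' _ hV) (r ≫ i')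
    obtain ⟨t, ht⟩ := ses_desc hs' (𝟙 G' - a ≫ b) (by
      rw [Preadditive.comp_sub, ← Category.assoc, ha, Category.assoc, hb, ← Category.assoc, hsr]
      simp)
    obtain ⟨I, hI, c, d, hcd⟩ := hfac t hV' hG'
    refine (hr2 _).2 fun Q hQ => ?_
    refine ext1_factor a b (p' ≫ c) d ?_ ((hr2 _).1 hG Q hQ) (ext1_inj Q I)
    rw [Category.assoc, hcd, ht]
    simp
  have keyA : ∀ {X G V : A} (i : X ⟶ G) (p : G ⟶ V), IsShortExact i p → G ∈ F₁ → V ∈ W₁ →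
      X ∈ beckerClass F₂ W₁ → G ∈ F₂ := by
    rintro X G V i p hs hG hV ⟨G', V', i', p', hs', hG', hV'⟩
    exact key (𝟙 X) (𝟙 X) i' p' i p (by simp) hs' hG' hV' hs hG hV
  have hF2 : ∀ X, X ∈ F₂ → X ∈ beckerClass F₂ W₁ := fun X hX =>
    ⟨X, _, _, _, ses_id_zero X hO, hX, hzero⟩
  have hWF : ∀ X, X ∈ beckerClass F₂ W₁ → X ∈ F₁ → X ∈ F₂ := fun X hX hX' =>
    keyA _ _ (ses_id_zero X hO) hX' hzero hX
  have hW1 : ∀ X, X ∈ W₁ → X ∈ beckerClass F₂ W₁ := fun X hX => by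
    have hs := ses_cokernel (Injective.ι X)
    exact ⟨_, _, _, _, hs, ((hinj2 _).2 inferInstance).2,
      (ht1 _ _ hs).1 hX ((hinj1 _).2 inferInstance).1⟩
  -- kernels of epis in `F₂`, inside `F₁`
  have hker : ∀ {X Y Z : A} {i : X ⟶ Y} {p : Y ⟶ Z}, IsShortExact i p → X ∈ F₁ → Y ∈ F₂ →
      Z ∈ F₂ → X ∈ F₂ := by
    intro X Y Z i p hs hX hY hZ
    obtain ⟨K, J, k, q, hK, hJ, hs'⟩ := hp2 Z
    have hJi : Injective J := (hinj2 J).1 ⟨hJ, hextF2 hs' hK hZ⟩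
    obtain ⟨P, a, b, c, d, hac, hbd, -⟩ := ses_pullback hs hs'
    have hP : P ∈ F₂ := hextF2 hac hK hY
    obtain ⟨r, hr⟩ := ext1_extend hbd ((hr1 X).1 hX _ ((hinj1 J).2 hJi).1) (𝟙 X)
    refine (hr2 _).2 fun Q hQ => ?_
    exact ext1_factor b r b (0 : P ⟶ X) (by simp [hr]) ((hr2 _).1 hP Q hQ) ((hr2 _).1 hP Q hQ)
  have hthick : IsThickClass (beckerClass F₂ W₁) := by
    constructor
    · rintro X Y s r hsr ⟨G, V, i, p, hs, hG, hV⟩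
      obtain ⟨G', V', i', p', hG', hV', hs'⟩ := he1 Y
      exact ⟨G', V', i', p', hs', key s r i p i' p' hsr hs hG hV hs' hG' hV', hV'⟩
    · intro X Y Z i p hs
      obtain ⟨G, V, f, q, hG, hV, hsX⟩ := he1 X
      obtain ⟨P, g, i', p', hs1, hs2, -⟩ := ses_pushout hs f
      obtain ⟨q', hs2⟩ := hs2 V q hsX
      obtain ⟨H, U, j, t, hH, hU, hsP⟩ := he1 P
      -- cokernel of `Y ⟶ P ⟶ H`
      obtain ⟨E, π, _, _, hE1, -, hE2⟩ := ses_pushout hsP q'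
      have hE2 := hE2 _ _ hs2
      have hE : E ∈ W₁ := (ht1 _ _ hE1).2.1 hV hU
      -- cokernel of `G ⟶ P ⟶ H`
      obtain ⟨C, π', _, _, hC1, -, hC2⟩ := ses_pushout hsP p'
      have hC2 := hC2 _ _ hs1
      have hC : C ∈ F₁ := hcok1 hC2 hG hH
      have mkX : G ∈ F₂ → X ∈ beckerClass F₂ W₁ := fun h => ⟨_, _, _, _, hsX, h, hV⟩
      have mkY : H ∈ F₂ → Y ∈ beckerClass F₂ W₁ := fun h => ⟨_, _, _, _, hE2, h, hE⟩
      have mkZ : C ∈ F₂ → Z ∈ beckerClass F₂ W₁ := fun h => ⟨_, _, _, _, hC1, h, hU⟩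
      have gX := keyA _ _ hsX hG hV
      have gY := keyA _ _ hE2 hH hE
      have gZ := keyA _ _ hC1 hC hU
      exact ⟨fun hx hy => mkZ (hcok2 hC2 (gX hx) (gY hy)),
        fun hx hz => mkY (hextF2 hC2 (gX hx) (gZ hz)),
        fun hy hz => mkX (hker hC2 hG (gY hy) (gZ hz))⟩
  have hWF' : beckerClass F₂ W₁ ∩ F₁ = F₂ := by
    ext X
    exact ⟨fun h => hWF X h.1 h.2, fun h => ⟨hF2 X h, hsub h⟩⟩
  have hWW' : W₂ ∩ beckerClass F₂ W₁ = W₁ := by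
    ext X
    refine ⟨?_, fun h => ⟨hW12 h, hW1 X h⟩⟩
    rintro ⟨hX, G, V, i, p, hs, hG, hV⟩
    have hGi := (hinj2 G).1 ⟨(ht2 _ _ hs).2.1 hX (hW12 hV), hG⟩
    exact (ht1 _ _ hs).2.2 ((hinj1 G).2 hGi).1 hV
  refine ⟨?_, hthick, ⟨hthick, ?_, ?_⟩, ?_⟩
  · ext X
    constructor
    · intro hX
      obtain ⟨G, V, i, p, hG, hV, hs⟩ := hp1 X
      exact ⟨G, V, i, p, hs, hWF G ((hthick.2 _ _ hs).2.2 (hW1 V hV) hX) hG, hV⟩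
    · rintro ⟨G, V, i, p, hs, hG, hV⟩
      exact (hthick.2 _ _ hs).1 (hF2 G hG) (hW1 V hV)
  · rw [hWF']
    exact hcc2
  · rw [hWW']
    exact ⟨⟨hl1, hr1⟩, hp1, he1⟩
  · intro X
    rw [← hinj1 X, ← and_assoc]
    have : (X ∈ W₂ ∧ X ∈ beckerClass F₂ W₁) ↔ X ∈ W₁ := by
      exact (Set.ext_iff.1 hWW' X)
    rw [this]
end

section
/- Let A be an abelian category with enough injectives, let (W, F) be an injective cotorsion pair, and let T be a class of objects of F containing all injective objects and F-thick (closed under direct summands, and two-out-of-three on short exact sequences with all terms in F). Let W_T = {A ∈ A | there exists a short exact sequence 0 → A → T → W → 0 with T ∈ T and W ∈ W}. Then: (1) every object X with Ext¹(A, X) = 0 for all A ∈ W_T lies in F; and (2) for an object F₀ ∈ F, one has Ext¹(A, F₀) = 0 for all A ∈ W_T if and only if every morphism T → F₀ with T ∈ T factors through an injective object of A. -/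
open CategoryTheory CategoryTheory.Limits

universe w v u

variable {A : Type u} [Category.{v} A] [Abelian A]

/-- `T` is an `F`-thick class: a subclass of `F` closed under direct summands and satisfying
two-out-of-three on short exact sequences all of whose terms lie in `F`. -/
def IsFThick (F T : Set A) : Prop :=
  (∀ (X Y : A) (s : Y ⟶ X) (r : X ⟶ Y), s ≫ r = 𝟙 Y → X ∈ T → Y ∈ T) ∧
  (∀ ⦃X Y Z : A⦄ (i : X ⟶ Y) (p : Y ⟶ Z), IsShortExact i p →
    X ∈ F → Y ∈ F → Z ∈ F →
    ((X ∈ T → Y ∈ T → Z ∈ T) ∧ (X ∈ T → Z ∈ T → Y ∈ T) ∧ (Y ∈ T → Z ∈ T → X ∈ T)))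

/-- `WClass W T` is the class of all objects `X` admitting a short exact sequence
`0 → X → T₀ → W₀ → 0` with `T₀ ∈ T` and `W₀ ∈ W`. -/
def WClass (W T : Set A) : Set A :=
  {X : A | ∃ (To Wo : A) (i : X ⟶ To) (p : To ⟶ Wo), IsShortExact i p ∧ To ∈ T ∧ Wo ∈ W}

open Abelian in
lemma aux_ext_eq_zero [HasExt.{w} A] {X Y : A} (h : Ext1Zero.{w} X Y) (e : Ext X Y 1) : e = 0 :=
  (h : Subsingleton _).elim _ _

open Abelian in
lemma aux_mk [HasExt.{w} A] {X Y : A} (h : ∀ e : Ext X Y 1, e = 0) : Ext1Zero.{w} X Y :=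
  subsingleton_of_forall_eq 0 h

open Abelian in
/-- If `Ext¹(Z, B) = 0` then morphisms `X ⟶ B` extend to `Y`. -/
lemma aux_extend [HasExt.{w} A] {X Y Z B : A} {i : X ⟶ Y} {p : Y ⟶ Z} (hs : IsShortExact i p)
    (h : Ext1Zero.{w} Z B) (f : X ⟶ B) : ∃ g : Y ⟶ B, i ≫ g = f := by
  obtain ⟨w, hS⟩ := hs
  obtain ⟨x, hx⟩ := Ext.contravariant_sequence_exact₁ hS B (Ext.mk₀ f) (add_zero 1)
    (aux_ext_eq_zero h _)
  obtain ⟨g, rfl⟩ := (Ext.mk₀_bijective _ _).2 x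
  rw [Ext.mk₀_comp_mk₀] at hx
  exact ⟨g, (Ext.mk₀_bijective _ _).1 hx⟩

open Abelian in
/-- If `Ext¹(B, X) = 0` then morphisms `B ⟶ Z` lift to `Y`. -/
lemma aux_lift [HasExt.{w} A] {X Y Z B : A} {i : X ⟶ Y} {p : Y ⟶ Z} (hs : IsShortExact i p)
    (h : Ext1Zero.{w} B X) (f : B ⟶ Z) : ∃ g : B ⟶ Y, g ≫ p = f := by
  obtain ⟨w, hS⟩ := hs
  obtain ⟨x, hx⟩ := Ext.covariant_sequence_exact₃ B hS (Ext.mk₀ f) (zero_add 1)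
    (aux_ext_eq_zero h _)
  obtain ⟨g, rfl⟩ := (Ext.mk₀_bijective _ _).2 x
  rw [Ext.mk₀_comp_mk₀] at hx
  exact ⟨g, (Ext.mk₀_bijective _ _).1 hx⟩

open Abelian in
lemma aux_zero_of_extend [HasExt.{w} A] {X Y Z B : A} {i : X ⟶ Y} {p : Y ⟶ Z}
    (hs : IsShortExact i p) (h : Ext1Zero.{w} Y B)
    (hf : ∀ f : X ⟶ B, ∃ g : Y ⟶ B, i ≫ g = f) : Ext1Zero.{w} Z B := by
  obtain ⟨w, hS⟩ := hs
  refine aux_mk fun e => ?_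
  obtain ⟨x, rfl⟩ := Ext.contravariant_sequence_exact₃ hS B e (aux_ext_eq_zero h _) (add_zero 1)
  obtain ⟨f, rfl⟩ := (Ext.mk₀_bijective _ _).2 x
  obtain ⟨g, rfl⟩ := hf f
  rw [← Ext.mk₀_comp_mk₀]
  exact hS.extClass_comp_assoc _

open Abelian in
lemma aux_zero_of_lift [HasExt.{w} A] {X Y Z B : A} {i : X ⟶ Y} {p : Y ⟶ Z}
    (hs : IsShortExact i p) (h : Ext1Zero.{w} B Y)
    (hf : ∀ f : B ⟶ Z, ∃ g : B ⟶ Y, g ≫ p = f) : Ext1Zero.{w} B X := by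
  obtain ⟨w, hS⟩ := hs
  refine aux_mk fun e => ?_
  obtain ⟨x, rfl⟩ := Ext.covariant_sequence_exact₁ B hS e (aux_ext_eq_zero h _) (zero_add 1)
  obtain ⟨f, rfl⟩ := (Ext.mk₀_bijective _ _).2 x
  obtain ⟨g, rfl⟩ := hf f
  have := hS.comp_extClass
  dsimp at this
  rw [← Ext.mk₀_comp_mk₀, Ext.comp_assoc_of_second_deg_zero, this, Ext.comp_zero]

open Abelian in
lemma aux_middle [HasExt.{w} A] {X Y Z B : A} {i : X ⟶ Y} {p : Y ⟶ Z} (hs : IsShortExact i p)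
    (hX : Ext1Zero.{w} B X) (hZ : Ext1Zero.{w} B Z) : Ext1Zero.{w} B Y := by
  obtain ⟨w, hS⟩ := hs
  refine aux_mk fun e => ?_
  obtain ⟨x, rfl⟩ := Ext.covariant_sequence_exact₂ B hS e (aux_ext_eq_zero hZ _)
  rw [aux_ext_eq_zero hX x, Ext.zero_comp]

lemma aux_inj [HasExt.{w} A] (X I : A) (hI : Injective I) : Ext1Zero.{w} X I :=
  Abelian.Ext.subsingleton_of_injective X I 0

lemma aux_ses_cokernel {X Y : A} (i : X ⟶ Y) [Mono i] : IsShortExact i (cokernel.π i) :=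
  ⟨cokernel.condition i,
    { exact := ShortComplex.exact_of_g_is_cokernel _ (cokernelIsCokernel i)
      mono_f := by assumption
      epi_g := by dsimp; infer_instance }⟩

lemma aux_ses_kernel {X Y : A} (p : X ⟶ Y) [Epi p] : IsShortExact (kernel.ι p) p :=
  ⟨kernel.condition p,
    { exact := ShortComplex.exact_of_f_is_kernel _ (kernelIsKernel p)
      mono_f := by dsimp; infer_instance
      epi_g := by assumption }⟩

/-- The right class of an injective cotorsion pair is closed under cosyzygies. -/
lemma aux_cosyzygy [EnoughInjectives A] [HasExt.{w} A] {W F : Set A}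
    (h : IsInjectiveCotorsionPair.{w} W F) {X I C : A} {i : X ⟶ I} {p : I ⟶ C}
    (hs : IsShortExact i p) (hX : X ∈ F) (hI : Injective I) : C ∈ F := by
  obtain ⟨⟨⟨hW, hF⟩, hc, -⟩, hth, -⟩ := h
  refine (hF C).2 fun V hV => ?_
  have hj := aux_ses_cokernel (Injective.ι C)
  refine aux_zero_of_lift hj (aux_inj _ _ inferInstance) fun g => ?_
  obtain ⟨K₀, V', _, c, _, hV', ⟨_, hc'⟩⟩ := hc (pullback (cokernel.π (Injective.ι C)) g)
  have : Epi c := hc'.epi_g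
  let q : V' ⟶ V := c ≫ pullback.snd _ _
  let a : V' ⟶ Injective.under C := c ≫ pullback.fst _ _
  have haq : a ≫ cokernel.π (Injective.ι C) = q ≫ g := by
    simp only [a, q, Category.assoc, pullback.condition]
  have : Epi q := by dsimp [q]; infer_instance
  have hK : kernel q ∈ W := (hth.2 _ _ (aux_ses_kernel q)).2.2 hV' hV
  obtain ⟨wj, hj'⟩ := hj
  have := hj'.mono_f
  obtain ⟨φ, hφ⟩ := hj'.exact.lift' (kernel.ι q ≫ a) (by
    dsimp; rw [Category.assoc, haq, kernel.condition_assoc, zero_comp])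
  dsimp at φ hφ
  obtain ⟨ψ, hψ⟩ := aux_lift hs ((hF X).1 hX _ hK) φ
  let b : V' ⟶ C := Injective.factorThru ψ (kernel.ι q) ≫ p
  have hb : kernel.ι q ≫ b = φ := by
    simp [b, hψ]
  obtain ⟨_, hq⟩ := aux_ses_kernel q
  have := hq.epi_g
  obtain ⟨t, ht⟩ := hq.exact.desc' (a - b ≫ Injective.ι C) (by
    dsimp
    rw [Preadditive.comp_sub, ← Category.assoc (kernel.ι q) b, hb, hφ, sub_self])
  dsimp at t ht
  refine ⟨t, ?_⟩
  rw [← cancel_epi q, ← Category.assoc, ht, Preadditive.sub_comp, haq]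
  simp

theorem right_perp_of_WClass [EnoughInjectives A] [HasExt.{w} A] (W F : Set A)
    (h : IsInjectiveCotorsionPair.{w} W F)
    (T : Set A) (hTF : T ⊆ F) (hTinj : ∀ X : A, Injective X → X ∈ T)
    (hT : IsFThick F T) :
    (∀ X : A, (∀ Y ∈ WClass W T, Ext1Zero.{w} Y X) → X ∈ F) ∧
    (∀ F₀ ∈ F, ((∀ Y ∈ WClass W T, Ext1Zero.{w} Y F₀) ↔
      ∀ T₀ ∈ T, ∀ f : T₀ ⟶ F₀, ∃ (I : A) (u : T₀ ⟶ I) (v : I ⟶ F₀),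
        Injective I ∧ u ≫ v = f)) := by
  have h0 := h
  obtain ⟨⟨⟨hW, hF⟩, hc, -⟩, hth, hinj⟩ := h
  refine ⟨fun X hX => (hF X).2 fun V hV => hX V ?_, fun F₀ hF₀ => ⟨fun hp T₀ hT₀ f => ?_,
    fun hp Y hY => ?_⟩⟩
  · have hs := aux_ses_cokernel (Injective.ι V)
    exact ⟨_, _, _, _, hs, hTinj _ inferInstance,
      (hth.2 _ _ hs).1 hV ((hinj _).2 inferInstance).1⟩
  · have hs := aux_ses_cokernel (Injective.ι T₀)
    have hI : Injective (Injective.under T₀) := inferInstance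
    have hC := aux_cosyzygy h0 hs (hTF hT₀) hI
    have hCT := (hT.2 _ _ hs (hTF hT₀) ((hinj _).2 hI).2 hC).1 hT₀ (hTinj _ hI)
    obtain ⟨g, hg⟩ := aux_extend hs (hp _ ⟨_, _, _, _, aux_ses_cokernel (𝟙 _), hCT, by
      have : IsZero (cokernel (𝟙 (cokernel (Injective.ι T₀)))) := isZero_cokernel_of_epi _
      exact ((hinj _).2 this.injective).1⟩) f
    exact ⟨_, _, g, hI, hg⟩
  · obtain ⟨T₁, W₁, i, p, hs, hT₁, hW₁⟩ := hY
    have hE : Ext1Zero.{w} T₁ F₀ := by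
      obtain ⟨F₁, I₁, i, p, hF₁, hI₁, hs⟩ := hc T₁
      have hI₁F : I₁ ∈ F := (hF _).2 fun V hV =>
        aux_middle hs ((hF _).1 hF₁ V hV) ((hF _).1 (hTF hT₁) V hV)
      have hI : Injective I₁ := (hinj _).1 ⟨hI₁, hI₁F⟩
      have hF₁T := (hT.2 _ _ hs hF₁ hI₁F (hTF hT₁)).2.2 (hTinj _ hI) hT₁
      refine aux_zero_of_extend hs ((hF _).1 hF₀ _ hI₁) fun f => ?_
      obtain ⟨J, u, v, hJ, rfl⟩ := hp _ hF₁T f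
      obtain ⟨_, hS⟩ := hs
      have : Mono i := hS.mono_f
      exact ⟨Injective.factorThru u i ≫ v, by simp⟩
    have hs' := aux_ses_cokernel (Injective.ι F₀)
    have hC := aux_cosyzygy h0 hs' hF₀ inferInstance
    have hE2 : ∀ e : Abelian.Ext W₁ F₀ 2, e = 0 := fun e => by
      obtain ⟨_, hS⟩ := hs'
      obtain ⟨x, rfl⟩ := Abelian.Ext.covariant_sequence_exact₁ W₁ hS e
        (Abelian.Ext.eq_zero_of_injective _) (one_add_one_eq_two)
      rw [aux_ext_eq_zero ((hF _).1 hC _ hW₁) x, Abelian.Ext.zero_comp]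
    obtain ⟨_, hS⟩ := hs
    refine aux_mk fun e => ?_
    obtain ⟨x, rfl⟩ := Abelian.Ext.contravariant_sequence_exact₁ hS F₀ e one_add_one_eq_two
      (hE2 _)
    rw [aux_ext_eq_zero hE x, Abelian.Ext.comp_zero]
end

section
/- Let A be an abelian category with enough injectives, let GI denote the class of Gorenstein injective objects of A, and let V = {X ∈ A | Ext¹(X, M) = 0 for all M ∈ GI}. If (V, GI) is a complete cotorsion pair, then it is an injective cotorsion pair: V is thick and V ∩ GI equals the class of injective objects of A. -/
open CategoryTheory CategoryTheory.Limits

universe w v u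

variable {A : Type u} [Category.{v} A] [Abelian A]

/-- `M` is Gorenstein injective: `M = Z₀ J` for some exact complex `J` of injectives which
remains exact after applying `Hom(I, -)` for every injective object `I`. -/
def IsGorensteinInjective (M : A) : Prop :=
  ∃ J : ChainComplex A ℤ,
    (∀ n : ℤ, Injective (J.X n)) ∧
    (∀ n : ℤ, (ShortComplex.mk (J.d (n + 1) n) (J.d n (n - 1)) (J.d_comp_d _ _ _)).Exact) ∧
    (∃ (ι : M ⟶ J.X 0) (w : ι ≫ J.d 0 (-1) = 0),
      Mono ι ∧ (ShortComplex.mk ι (J.d 0 (-1)) w).Exact) ∧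
    (∀ (I : A), Injective I → ∀ (n : ℤ) (f : I ⟶ J.X n), f ≫ J.d n (n - 1) = 0 →
      ∃ g : I ⟶ J.X (n + 1), g ≫ J.d (n + 1) n = f)

/-- Short exact sequence `0 → N → J_a → M → 0` of cycles in an exact sequence. -/
lemma giAux_ses {P Q R M N : A} (f : P ⟶ Q) (g : Q ⟶ R) (w : f ≫ g = 0)
    (hex : (ShortComplex.mk f g w).Exact)
    (ιM : M ⟶ Q) (wM : ιM ≫ g = 0) [Mono ιM] (hM : (ShortComplex.mk ιM g wM).Exact)
    (ιN : N ⟶ P) (wN : ιN ≫ f = 0) [Mono ιN] (hN : (ShortComplex.mk ιN f wN).Exact) :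
    ∃ p : P ⟶ M, p ≫ ιM = f ∧ IsShortExact ιN p := by
  have : Mono (ShortComplex.mk ιM g wM).f := ‹Mono ιM›
  obtain ⟨p, hp⟩ : ∃ p : P ⟶ M, p ≫ ιM = f := ⟨hM.lift f w, hM.lift_f f w⟩
  have w0 : ιN ≫ p = 0 := by
    rw [← cancel_mono ιM, Category.assoc, hp, wN, zero_comp]
  refine ⟨p, hp, w0, ?_⟩
  have : Mono (ShortComplex.mk ιN p w0).f := ‹Mono ιN›
  have : Epi (ShortComplex.mk ιN p w0).g := by
    change Epi p
    obtain ⟨T, π, hπ, x, hx⟩ := hex.exact_up_to_refinements ιM wM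
    have : π = x ≫ p := by
      rw [← cancel_mono ιM, Category.assoc, hp]; exact hx
    have : Epi (x ≫ p) := this ▸ hπ
    exact epi_of_epi x p
  refine ShortComplex.ShortExact.mk ?_
  rw [ShortComplex.exact_iff_exact_up_to_refinements] at hN ⊢
  intro T x hx
  exact hN x (by
    change x ≫ f = 0
    change x ≫ p = 0 at hx
    rw [← hp, reassoc_of% hx, zero_comp])

/-- Every cycle object of a totally acyclic complex of injectives is Gorenstein injective. -/
lemma giAux_cycles (J : ChainComplex A ℤ) (hinj : ∀ n : ℤ, Injective (J.X n))
    (hex : ∀ n : ℤ,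
      (ShortComplex.mk (J.d (n + 1) n) (J.d n (n - 1)) (J.d_comp_d _ _ _)).Exact)
    (hhom : ∀ (I : A), Injective I → ∀ (n : ℤ) (f : I ⟶ J.X n), f ≫ J.d n (n - 1) = 0 →
      ∃ g : I ⟶ J.X (n + 1), g ≫ J.d (n + 1) n = f)
    (k a b : ℤ) (ha : a = 0 + k) (hb : b = -1 + k) (M : A)
    (ι : M ⟶ J.X a) (w : ι ≫ J.d a b = 0) (hm : Mono ι)
    (he : (ShortComplex.mk ι (J.d a b) w).Exact) : IsGorensteinInjective M := by
  subst ha hb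
  have hex' : ∀ p q r : ℤ, p = q + 1 → r = q - 1 →
      (ShortComplex.mk (J.d p q) (J.d q r) (J.d_comp_d _ _ _)).Exact := by
    rintro p q r rfl rfl; exact hex q
  have hhom' : ∀ (I : A), Injective I → ∀ (p q r : ℤ), p = q + 1 → r = q - 1 →
      ∀ (f : I ⟶ J.X q), f ≫ J.d q r = 0 → ∃ g : I ⟶ J.X p, g ≫ J.d p q = f := by
    rintro I hI p q r rfl rfl; exact hhom I hI q
  refine ⟨{ X := fun n => J.X (n + k)
            d := fun i j => J.d (i + k) (j + k)
            shape := fun i j hij => J.shape _ _ (fun h => hij (by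
              change _ + 1 = _ at h
              change _ + 1 = _
              lia))
            d_comp_d' := fun i j l _ _ => J.d_comp_d _ _ _ }, ?_, ?_, ⟨ι, w, hm, he⟩, ?_⟩
  · intro n; exact hinj _
  · intro n; exact hex' _ _ _ (by lia) (by lia)
  · intro I hI n f hf; exact hhom' I hI _ _ _ (by lia) (by lia) f hf

/-- Cosyzygies of Gorenstein injective objects. -/
lemma giAux_cosyzygy {M : A} (hM : IsGorensteinInjective M) :
    ∃ (I M' : A) (i : M ⟶ I) (p : I ⟶ M'), Injective I ∧ IsGorensteinInjective M' ∧
      IsShortExact i p ∧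
      ∀ (K : A), Injective K → ∀ f : K ⟶ M', ∃ g : K ⟶ I, g ≫ p = f := by
  obtain ⟨J, hinj, hex, ⟨ι, w, hm, he⟩, hhom⟩ := hM
  have hex' : ∀ p q r : ℤ, p = q + 1 → r = q - 1 →
      (ShortComplex.mk (J.d p q) (J.d q r) (J.d_comp_d _ _ _)).Exact := by
    rintro p q r rfl rfl; exact hex q
  have hhom' : ∀ (I : A), Injective I → ∀ (p q r : ℤ), p = q + 1 → r = q - 1 →
      ∀ (f : I ⟶ J.X q), f ≫ J.d q r = 0 → ∃ g : I ⟶ J.X p, g ≫ J.d p q = f := by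
    rintro I hI p q r rfl rfl; exact hhom I hI q
  have w' : kernel.ι (J.d (-1) (-2)) ≫ J.d (-1) (-2) = 0 := kernel.condition _
  have hk : (ShortComplex.mk _ _ w').Exact := ShortComplex.exact_kernel _
  obtain ⟨p, hp, hse⟩ := giAux_ses (J.d 0 (-1)) (J.d (-1) (-2)) (J.d_comp_d _ _ _)
    (hex' _ _ _ (by lia) (by lia)) _ w' hk ι w he
  refine ⟨J.X 0, _, ι, p, hinj 0, giAux_cycles J hinj hex hhom (-1) (-1) (-2) (by lia) (by lia)
    _ _ w' inferInstance hk, hse, ?_⟩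
  intro K hK f
  obtain ⟨g, hg⟩ := hhom' K hK 0 (-1) (-2) (by lia) (by lia) (f ≫ kernel.ι (J.d (-1) (-2)))
    (by rw [Category.assoc, w', comp_zero])
  refine ⟨g, ?_⟩
  rw [← cancel_mono (kernel.ι (J.d (-1) (-2))), Category.assoc, hp]
  exact hg

/-- Syzygies of Gorenstein injective objects. -/
lemma giAux_syzygy {M : A} (hM : IsGorensteinInjective M) :
    ∃ (I N : A) (i : N ⟶ I) (p : I ⟶ M), Injective I ∧ IsGorensteinInjective N ∧
      IsShortExact i p := by
  obtain ⟨J, hinj, hex, ⟨ι, w, hm, he⟩, hhom⟩ := hM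
  have hex' : ∀ p q r : ℤ, p = q + 1 → r = q - 1 →
      (ShortComplex.mk (J.d p q) (J.d q r) (J.d_comp_d _ _ _)).Exact := by
    rintro p q r rfl rfl; exact hex q
  have w' : kernel.ι (J.d 1 0) ≫ J.d 1 0 = 0 := kernel.condition _
  have hk : (ShortComplex.mk _ _ w').Exact := ShortComplex.exact_kernel _
  obtain ⟨p, hp, hse⟩ := giAux_ses (J.d 1 0) (J.d 0 (-1)) (J.d_comp_d _ _ _)
    (hex' _ _ _ (by lia) (by lia)) ι w he _ w' hk
  exact ⟨J.X 1, _, _, p, hinj 1, giAux_cycles J hinj hex hhom 1 1 0 (by lia) (by lia)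
    _ _ w' inferInstance hk, hse⟩

section ExtAux

variable [HasExt.{w} A]

open Abelian

/-- Dimension shifting down: `Ext¹(Z, M') = 0` gives `Ext²(Z, M) = 0`. -/
lemma giAux_ext_two {S : ShortComplex A} (hS : S.ShortExact) [Injective S.X₂] (Z : A)
    (h : Ext1Zero.{w} Z S.X₃) (x : Ext.{w} Z S.X₁ 2) : x = 0 := by
  obtain ⟨y, rfl⟩ := Ext.covariant_sequence_exact₁ Z hS x
    (Ext.eq_zero_of_injective (n := 1) _) (n₀ := 1) rfl
  have : Subsingleton (Ext.{w} Z S.X₃ 1) := h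
  rw [Subsingleton.elim y 0, Ext.zero_comp]

/-- Dimension shifting up: `Ext²(Z, N) = 0` gives `Ext¹(Z, M) = 0`. -/
lemma giAux_ext_one {S : ShortComplex A} (hS : S.ShortExact) [Injective S.X₂] (Z : A)
    (h : ∀ x : Ext.{w} Z S.X₁ 2, x = 0) : Ext1Zero.{w} Z S.X₃ := by
  refine subsingleton_of_forall_eq 0 (fun x => ?_)
  obtain ⟨y, rfl⟩ := Ext.covariant_sequence_exact₃ Z hS x (n₁ := 2) rfl (h _)
  rw [Ext.eq_zero_of_injective (n := 0) y, Ext.zero_comp]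

end ExtAux

theorem gorenstein_injective_cotorsion_pair_is_injective [EnoughInjectives A] [HasExt.{w} A]
    (h : IsCompleteCotorsionPair.{w}
      {X : A | ∀ M : A, IsGorensteinInjective M → Ext1Zero.{w} X M}
      {M : A | IsGorensteinInjective M}) :
    IsInjectiveCotorsionPair.{w}
      {X : A | ∀ M : A, IsGorensteinInjective M → Ext1Zero.{w} X M}
      {M : A | IsGorensteinInjective M} := by
  open Abelian in
  have inj_left : ∀ K : A, Injective K → ∀ M : A, IsGorensteinInjective M →
      Ext1Zero.{w} K M := by
    intro K hK M hM
    obtain ⟨I, M', i, p, hI, hM', ⟨wS, hS⟩, hl⟩ := giAux_cosyzygy hM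
    refine subsingleton_of_forall_eq 0 (fun x => ?_)
    have : Injective (ShortComplex.mk i p wS).X₂ := hI
    obtain ⟨y, rfl⟩ := Ext.covariant_sequence_exact₁ K hS x
      (Ext.eq_zero_of_injective (n := 0) _) (n₀ := 0) rfl
    obtain ⟨f, rfl⟩ := Ext.homEquiv₀.symm.surjective y
    obtain ⟨g, hg⟩ := hl K hK f
    have h1 : Ext.homEquiv₀.symm f =
        (Ext.mk₀ g).comp (Ext.mk₀ (ShortComplex.mk i p wS).g) (add_zero 0) := by
      rw [Ext.mk₀_comp_mk₀]
      exact congrArg Ext.mk₀ hg.symm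
    rw [h1, Ext.comp_assoc_of_second_deg_zero, hS.comp_extClass, Ext.comp_zero]
  refine ⟨h, ⟨?_, ?_⟩, ?_⟩
  · intro X Y s r hsr hX M hM
    refine subsingleton_of_forall_eq 0 (fun x => ?_)
    have : Subsingleton (Abelian.Ext.{w} X M 1) := hX M hM
    rw [← Abelian.Ext.mk₀_id_comp x, ← hsr, ← Abelian.Ext.mk₀_comp_mk₀_assoc,
      Subsingleton.elim ((Abelian.Ext.mk₀ r).comp x (zero_add 1)) 0, Abelian.Ext.comp_zero]
  · rintro X Y Z i p ⟨wS, hS⟩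
    refine ⟨?_, ?_, ?_⟩
    · intro hX hY M hM
      obtain ⟨I, N, j, q, hI, hN, ⟨wT, hT⟩⟩ := giAux_syzygy hM
      have : Injective (ShortComplex.mk j q wT).X₂ := hI
      refine giAux_ext_one hT Z (fun x => ?_)
      obtain ⟨y, rfl⟩ := Abelian.Ext.contravariant_sequence_exact₃ hS N x
        (giAux_ext_two hT Y (hY M hM) _) (n₀ := 1) rfl
      have : Subsingleton (Abelian.Ext.{w} X N 1) := hX N hN
      have hy : y = 0 := Subsingleton.elim (α := Abelian.Ext.{w} X N 1) y 0
      rw [hy, Abelian.Ext.comp_zero]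
    · intro hX hZ M hM
      refine subsingleton_of_forall_eq 0 (fun x => ?_)
      have h1 : Subsingleton (Abelian.Ext.{w} X M 1) := hX M hM
      have h3 : Subsingleton (Abelian.Ext.{w} Z M 1) := hZ M hM
      obtain ⟨y, rfl⟩ := Abelian.Ext.contravariant_sequence_exact₂ hS M x
        (Subsingleton.elim (α := Abelian.Ext.{w} X M 1) _ _)
      have hy : y = 0 := Subsingleton.elim (α := Abelian.Ext.{w} Z M 1) y 0
      rw [hy, Abelian.Ext.comp_zero]
    · intro hY hZ M hM
      obtain ⟨I, M', j, q, hI, hM', ⟨wT, hT⟩, -⟩ := giAux_cosyzygy hM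
      have : Injective (ShortComplex.mk j q wT).X₂ := hI
      refine subsingleton_of_forall_eq 0 (fun x => ?_)
      have h2 : Subsingleton (Abelian.Ext.{w} Y M 1) := hY M hM
      obtain ⟨y, rfl⟩ := Abelian.Ext.contravariant_sequence_exact₁ hS M x (n₁ := 2) rfl
        (giAux_ext_two hT Z (hZ M' hM') _)
      have hy : y = 0 := Subsingleton.elim (α := Abelian.Ext.{w} Y M 1) y 0
      rw [hy, Abelian.Ext.comp_zero]
  · intro X
    constructor
    · rintro ⟨hV, hG⟩
      obtain ⟨I, N, j, q, hI, hN, ⟨wT, hT⟩⟩ := giAux_syzygy hG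
      have h1 : Subsingleton (Abelian.Ext.{w} X N 1) := hV N hN
      obtain ⟨y, hy⟩ := Abelian.Ext.covariant_sequence_exact₃ X hT (Abelian.Ext.mk₀ (𝟙 X))
        (n₁ := 1) rfl (Subsingleton.elim (α := Abelian.Ext.{w} X N 1) _ _)
      obtain ⟨f, rfl⟩ := Abelian.Ext.homEquiv₀.symm.surjective y
      have hf : f ≫ q = 𝟙 X := Abelian.Ext.homEquiv₀.symm.injective (by simpa using hy)
      exact Retract.injective (Y := I) ⟨f, q, hf⟩
    · intro hX
      refine ⟨inj_left X hX, (h.1.2 X).2 (fun V _ => ?_)⟩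
      exact Abelian.Ext.subsingleton_of_injective V X 0
end

section
/- Let A be an abelian category with enough projectives and let GP denote the class of Gorenstein projective objects of A. Then: (1) for every projective cotorsion pair (C, W) in A, one has C ⊆ GP; and (2) if (GP, GP^⊥) is a complete cotorsion pair, where GP^⊥ = {X | Ext¹(M, X) = 0 for all M ∈ GP}, then it is a projective cotorsion pair: GP^⊥ is thick and GP ∩ GP^⊥ equals the class of projective objects of A. -/
open CategoryTheory CategoryTheory.Limits

universe w v u

variable {A : Type u} [Category.{v} A] [Abelian A]

/-- `M` is Gorenstein projective: `M = Z₀ Q` for some exact complex `Q` of projectives which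
remains exact after applying `Hom(-, P)` for every projective object `P`. -/
def IsGorensteinProjective (M : A) : Prop :=
  ∃ Q : ChainComplex A ℤ,
    (∀ n : ℤ, Projective (Q.X n)) ∧
    (∀ n : ℤ, (ShortComplex.mk (Q.d (n + 1) n) (Q.d n (n - 1)) (Q.d_comp_d _ _ _)).Exact) ∧
    (∃ (ι : M ⟶ Q.X 0) (w : ι ≫ Q.d 0 (-1) = 0),
      Mono ι ∧ (ShortComplex.mk ι (Q.d 0 (-1)) w).Exact) ∧
    (∀ (P : A), Projective P → ∀ (n : ℤ) (f : Q.X n ⟶ P), Q.d (n + 1) n ≫ f = 0 →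
      ∃ g : Q.X (n - 1) ⟶ P, Q.d n (n - 1) ≫ g = f)

namespace GPAux

open scoped ZeroObject

lemma se_mono {X Y Z : A} {i : X ⟶ Y} {p : Y ⟶ Z} (h : IsShortExact i p) : Mono i := h.2.mono_f

lemma se_epi {X Y Z : A} {i : X ⟶ Y} {p : Y ⟶ Z} (h : IsShortExact i p) : Epi p := h.2.epi_g

lemma se_zero {X Y Z : A} {i : X ⟶ Y} {p : Y ⟶ Z} (h : IsShortExact i p) : i ≫ p = 0 := h.1

lemma se_lift {X Y Z T : A} {i : X ⟶ Y} {p : Y ⟶ Z} (h : IsShortExact i p) (k : T ⟶ Y)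
    (hk : k ≫ p = 0) : ∃ l : T ⟶ X, l ≫ i = k := by
  obtain ⟨w, h⟩ := h
  have := h.mono_f
  exact ⟨h.exact.lift k hk, h.exact.lift_f k hk⟩

lemma se_desc {X Y Z T : A} {i : X ⟶ Y} {p : Y ⟶ Z} (h : IsShortExact i p) (k : Y ⟶ T)
    (hk : i ≫ k = 0) : ∃ l : Z ⟶ T, p ≫ l = k := by
  obtain ⟨w, h⟩ := h
  have := h.epi_g
  exact ⟨h.exact.desc k hk, h.exact.g_desc k hk⟩

lemma se_cokernel {X Y : A} (i : X ⟶ Y) [Mono i] : IsShortExact i (cokernel.π i) :=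
  ⟨cokernel.condition i, ShortComplex.ShortExact.mk' (ShortComplex.exact_cokernel i)
    (by dsimp; infer_instance) (by dsimp; infer_instance)⟩

lemma se_kernel {X Y : A} (p : X ⟶ Y) [Epi p] : IsShortExact (kernel.ι p) p :=
  ⟨kernel.condition p, ShortComplex.ShortExact.mk' (ShortComplex.exact_kernel p)
    (by dsimp; infer_instance) (by dsimp; infer_instance)⟩

/-- The class-based sufficient criterion for being Gorenstein projective. -/
structure GClass (G : Set A) : Prop where
  right : ∀ X ∈ G, ∃ (P Y : A) (i : X ⟶ P) (p : P ⟶ Y), Projective P ∧ Y ∈ G ∧ IsShortExact i p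
  left : ∀ X ∈ G, ∃ (Y P : A) (i : Y ⟶ P) (p : P ⟶ X), Projective P ∧ Y ∈ G ∧ IsShortExact i p
  extend : ∀ (X Y Z P : A) (i : X ⟶ Y) (p : Y ⟶ Z), IsShortExact i p → Z ∈ G → Projective Y →
    Projective P → ∀ f : X ⟶ P, ∃ g : Y ⟶ P, i ≫ g = f

lemma exists_int_seq {α : Type*} (G : Set α) (R : α → α → Prop)
    (hr : ∀ x ∈ G, ∃ y ∈ G, R x y) (hl : ∀ x ∈ G, ∃ y ∈ G, R y x) (x : α) (hx : x ∈ G) :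
    ∃ Z : ℤ → α, Z 0 = x ∧ (∀ n, Z n ∈ G) ∧ ∀ m, R (Z (m + 1)) (Z m) := by
  choose r hrG hrR using hr
  choose l hlG hlR using hl
  let r' : G → G := fun y => ⟨r y.1 y.2, hrG _ _⟩
  let l' : G → G := fun y => ⟨l y.1 y.2, hlG _ _⟩
  let Z : ℤ → G := fun n => match n with
    | Int.ofNat k => l'^[k] ⟨x, hx⟩
    | Int.negSucc k => r'^[k + 1] ⟨x, hx⟩
  refine ⟨fun n => (Z n).1, rfl, fun n => (Z n).2, fun m => ?_⟩
  rcases m with k | k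
  · have : Z (Int.ofNat k + 1) = l' (Z (Int.ofNat k)) := by
      change l'^[k + 1] _ = l' (l'^[k] _)
      rw [Function.iterate_succ_apply']
    change R (Z (Int.ofNat k + 1)).1 (Z (Int.ofNat k)).1
    rw [this]
    exact hlR _ _
  · have : Z (Int.negSucc k) = r' (Z (Int.negSucc k + 1)) := by
      cases k with
      | zero => rfl
      | succ k =>
        change r'^[k + 1 + 1] _ = r' (r'^[k + 1] _)
        rw [Function.iterate_succ_apply']
    change R (Z (Int.negSucc k + 1)).1 (Z (Int.negSucc k)).1
    rw [this]
    exact hrR _ _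

lemma exact_glue {Q₁ Z₁ Q₀ Z₀ Q' : A} (p₁ : Q₁ ⟶ Z₁) (i₁ : Z₁ ⟶ Q₀) (p₀ : Q₀ ⟶ Z₀)
    (i₀ : Z₀ ⟶ Q') [Epi p₁] [Mono i₀] (h : IsShortExact i₁ p₀)
    (w : (p₁ ≫ i₁) ≫ p₀ ≫ i₀ = 0) : (ShortComplex.mk (p₁ ≫ i₁) (p₀ ≫ i₀) w).Exact := by
  obtain ⟨w', h⟩ := h
  let S₁ := ShortComplex.mk (p₁ ≫ i₁) (p₀ ≫ i₀) w
  let S₂ := ShortComplex.mk (p₁ ≫ i₁) p₀ (by simp [w'])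
  let S₃ := ShortComplex.mk i₁ p₀ w'
  let φ : S₂ ⟶ S₁ := { τ₁ := 𝟙 _, τ₂ := 𝟙 _, τ₃ := i₀ }
  let ψ : S₂ ⟶ S₃ := { τ₁ := p₁, τ₂ := 𝟙 _, τ₃ := 𝟙 _ }
  have : Epi φ.τ₁ := inferInstanceAs (Epi (𝟙 _))
  have : IsIso φ.τ₂ := inferInstanceAs (IsIso (𝟙 _))
  have : Mono φ.τ₃ := inferInstanceAs (Mono i₀)
  have : Epi ψ.τ₁ := inferInstanceAs (Epi p₁)
  have : IsIso ψ.τ₂ := inferInstanceAs (IsIso (𝟙 _))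
  have : Mono ψ.τ₃ := inferInstanceAs (Mono (𝟙 _))
  exact (ShortComplex.exact_iff_of_epi_of_isIso_of_mono φ).1
    ((ShortComplex.exact_iff_of_epi_of_isIso_of_mono ψ).2 h.exact)

lemma exact_glue' {Z₁ Q₀ Z₀ Q' : A} (i₁ : Z₁ ⟶ Q₀) (p₀ : Q₀ ⟶ Z₀)
    (i₀ : Z₀ ⟶ Q') [Mono i₀] (h : IsShortExact i₁ p₀)
    (w : i₁ ≫ p₀ ≫ i₀ = 0) : (ShortComplex.mk i₁ (p₀ ≫ i₀) w).Exact := by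
  have := exact_glue (𝟙 Z₁) i₁ p₀ i₀ h (by simpa using w)
  simpa using this

lemma GClass.isGP {G : Set A} (hG : GClass G) (X : A) (hX : X ∈ G) :
    IsGorensteinProjective X := by
  obtain ⟨Z, hZ0, hZG, hZ⟩ := exists_int_seq G
    (fun X Y => ∃ (P : A) (i : X ⟶ P) (p : P ⟶ Y), Projective P ∧ IsShortExact i p)
    (fun X hX => by
      obtain ⟨P, Y, i, p, hP, hY, h⟩ := hG.right X hX
      exact ⟨Y, hY, P, i, p, hP, h⟩)
    (fun X hX => by
      obtain ⟨Y, P, i, p, hP, hY, h⟩ := hG.left X hX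
      exact ⟨Y, hY, P, i, p, hP, h⟩) X hX
  subst hZ0
  have key : ∀ n, ∃ (P : A) (i : Z n ⟶ P), Projective P ∧ ∀ m, m + 1 = n →
      ∃ p : P ⟶ Z m, IsShortExact i p := by
    intro n
    obtain ⟨m, rfl⟩ : ∃ m, m + 1 = n := ⟨n - 1, by ring⟩
    obtain ⟨P, i, p, hP, h⟩ := hZ m
    refine ⟨P, i, hP, fun m' hm' => ?_⟩
    obtain rfl : m' = m := by omega
    exact ⟨p, h⟩
  choose P i hP p hp using key
  let d : ∀ n m, P n ⟶ P m := fun n m => if h : m + 1 = n then p n m h ≫ i m else 0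
  have hd : ∀ n m (h : m + 1 = n), d n m = p n m h ≫ i m := fun n m h => dif_pos h
  let Q : ChainComplex A ℤ :=
    { X := P
      d := d
      shape := fun n m h => dif_neg h
      d_comp_d' := fun a b c (hab : b + 1 = a) (hbc : c + 1 = b) => by
        rw [hd _ _ hab, hd _ _ hbc]
        rw [Category.assoc, ← Category.assoc (i b), se_zero (hp b c hbc), zero_comp, comp_zero] }
  refine ⟨Q, hP, ?_, ?_, ?_⟩
  · intro n
    have h1 : Q.d (n + 1) n = p (n + 1) n rfl ≫ i n := hd _ _ _
    have h2 : Q.d n (n - 1) = p n (n - 1) (by ring) ≫ i (n - 1) := hd _ _ _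
    have := se_epi (hp (n + 1) n rfl)
    have := se_mono (hp (n - 1) (n - 1 - 1) (by ring))
    have := exact_glue (p (n + 1) n rfl) (i n) (p n (n - 1) (by ring)) (i (n - 1))
      (hp n (n - 1) (by ring)) (by rw [← h1, ← h2]; exact Q.d_comp_d _ _ _)
    simp only [← h1, ← h2] at this
    exact this
  · have h2 : Q.d 0 (-1) = p 0 (-1) (by ring) ≫ i (-1) := hd 0 (-1) _
    have := se_mono (hp (-1) (-1 - 1) (by ring))
    have w : i 0 ≫ Q.d 0 (-1) = 0 := by
      rw [h2]
      exact (Category.assoc _ _ _).symm.trans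
        (by rw [se_zero (hp 0 (-1) (by ring)), zero_comp])
    refine ⟨i 0, w, se_mono (hp 0 (-1) (by ring)), ?_⟩
    have := exact_glue' (i 0) (p 0 (-1) (by ring)) (i (-1)) (hp 0 (-1) (by ring))
      (by rw [← h2]; exact w)
    simp only [← h2] at this
    exact this
  · intro P' hP' n f hf
    have h1 : Q.d (n + 1) n = p (n + 1) n rfl ≫ i n := hd _ _ _
    have h2 : Q.d n (n - 1) = p n (n - 1) (by ring) ≫ i (n - 1) := hd _ _ _
    have := se_epi (hp (n + 1) n rfl)
    have hf' : i n ≫ f = 0 := by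
      rw [← cancel_epi (p (n + 1) n rfl), comp_zero, ← hf, h1]
      exact (Category.assoc _ _ _).symm
    obtain ⟨l, hl⟩ := se_desc (hp n (n - 1) (by ring)) f hf'
    obtain ⟨g, hg⟩ := hG.extend _ _ _ P' _ _ (hp (n - 1) (n - 1 - 1) (by ring)) (hZG _) (hP _) hP' l
    exact ⟨g, by rw [h2, Category.assoc, hg, hl]⟩

/-- The class of cycles of a complete resolution. -/
def cyc (Q : ChainComplex A ℤ) : Set A := {X | ∃ (n : ℤ) (ι : X ⟶ Q.X n)
  (w : ι ≫ Q.d n (n - 1) = 0), Mono ι ∧ (ShortComplex.mk ι (Q.d n (n - 1)) w).Exact}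

lemma exact_transport (Q : ChainComplex A ℤ)
    (hQ : ∀ n : ℤ, (ShortComplex.mk (Q.d (n + 1) n) (Q.d n (n - 1)) (Q.d_comp_d _ _ _)).Exact)
    (a b c : ℤ) (hab : b + 1 = a) (hbc : c + 1 = b) :
    (ShortComplex.mk (Q.d a b) (Q.d b c) (Q.d_comp_d _ _ _)).Exact := by
  subst hab
  obtain rfl : c = b - 1 := by omega
  exact hQ b

lemma cyc_se (Q : ChainComplex A ℤ)
    (hQ : ∀ n : ℤ, (ShortComplex.mk (Q.d (n + 1) n) (Q.d n (n - 1)) (Q.d_comp_d _ _ _)).Exact)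
    (a b c : ℤ) (hab : b + 1 = a) (hbc : c + 1 = b) {X Y : A} (ι : X ⟶ Q.X a) (κ : Y ⟶ Q.X b)
    (w : ι ≫ Q.d a b = 0) (w' : κ ≫ Q.d b c = 0) [Mono ι] [Mono κ]
    (hι : (ShortComplex.mk ι (Q.d a b) w).Exact) (hκ : (ShortComplex.mk κ (Q.d b c) w').Exact) :
    ∃ p : Q.X a ⟶ Y, p ≫ κ = Q.d a b ∧ IsShortExact ι p := by
  have hab' := exact_transport Q hQ a b c hab hbc
  have : Mono (ShortComplex.mk κ (Q.d b c) w').f := ‹Mono κ›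
  let p : Q.X a ⟶ Y := hκ.lift (Q.d a b) (Q.d_comp_d _ _ _)
  have hp : p ≫ κ = Q.d a b := hκ.lift_f _ _
  have wp : ι ≫ p = 0 := by rw [← cancel_mono κ, Category.assoc, hp, w, zero_comp]
  refine ⟨p, hp, wp, ShortComplex.ShortExact.mk' ?_ ‹Mono ι› ?_⟩
  · let φ : ShortComplex.mk ι p wp ⟶ ShortComplex.mk ι (Q.d a b) w :=
      { τ₁ := 𝟙 _, τ₂ := 𝟙 _, τ₃ := κ, comm₂₃ := by simp [hp] }
    have : Epi φ.τ₁ := inferInstanceAs (Epi (𝟙 _))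
    have : IsIso φ.τ₂ := inferInstanceAs (IsIso (𝟙 _))
    have : Mono φ.τ₃ := ‹Mono κ›
    exact (ShortComplex.exact_iff_of_epi_of_isIso_of_mono φ).2 hι
  · rw [ShortComplex.exact_iff_epi_kernel_lift] at hab'
    dsimp at hab'
    let e : kernel (Q.d b c) ⟶ Y := hκ.lift (kernel.ι (Q.d b c)) (kernel.condition _)
    have he : e ≫ κ = kernel.ι _ := hκ.lift_f _ _
    have hpe : p = kernel.lift (Q.d b c) (Q.d a b) (Q.d_comp_d _ _ _) ≫ e := by
      rw [← cancel_mono κ, Category.assoc, he, hp, kernel.lift_ι]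
    have hse : kernel.lift _ κ w' ≫ e = 𝟙 _ := by
      rw [← cancel_mono κ, Category.assoc, he, kernel.lift_ι, Category.id_comp]
    have : IsSplitEpi e := ⟨⟨⟨_, hse⟩⟩⟩
    change Epi p
    rw [hpe]
    exact epi_comp _ _

/-- Extending maps along `X → Y` with cokernel `Z` only depends on `Z`, for `Y` projective. -/
lemma extend_indep {X Y Z X' Y' T : A} {i : X ⟶ Y} {p : Y ⟶ Z} {i' : X' ⟶ Y'} {p' : Y' ⟶ Z}
    (h : IsShortExact i p) (h' : IsShortExact i' p') [Projective Y] [Projective Y']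
    (H : ∀ f : X' ⟶ T, ∃ g, i' ≫ g = f) (f : X ⟶ T) : ∃ g, i ≫ g = f := by
  have := se_epi h
  have := se_epi h'
  have := se_mono h
  let a : Y ⟶ Y' := Projective.factorThru p p'
  let b : Y' ⟶ Y := Projective.factorThru p' p
  have ha : a ≫ p' = p := Projective.factorThru_comp _ _
  have hb : b ≫ p = p' := Projective.factorThru_comp _ _
  obtain ⟨b', hb'⟩ := se_lift h (i' ≫ b) (by rw [Category.assoc, hb, se_zero h'])
  obtain ⟨a', ha'⟩ := se_lift h' (i ≫ a) (by rw [Category.assoc, ha, se_zero h])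
  obtain ⟨c, hc⟩ := se_lift h (𝟙 Y - a ≫ b) (by simp [ha, hb])
  obtain ⟨g, hg⟩ := H (b' ≫ f)
  have hic : i ≫ c = 𝟙 X - a' ≫ b' := by
    rw [← cancel_mono i, Category.assoc, hc]
    simp only [Preadditive.comp_sub, Preadditive.sub_comp, Category.comp_id, Category.id_comp,
      Category.assoc, hb']
    rw [← Category.assoc a', ha', Category.assoc]
  refine ⟨a ≫ g + c ≫ f, ?_⟩
  rw [Preadditive.comp_add, ← Category.assoc, ← ha', Category.assoc, hg, ← Category.assoc i c, hic]
  simp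

lemma cyc_gclass (Q : ChainComplex A ℤ) (hP : ∀ n : ℤ, Projective (Q.X n))
    (hQ : ∀ n : ℤ, (ShortComplex.mk (Q.d (n + 1) n) (Q.d n (n - 1)) (Q.d_comp_d _ _ _)).Exact)
    (hH : ∀ (P : A), Projective P → ∀ (n : ℤ) (f : Q.X n ⟶ P), Q.d (n + 1) n ≫ f = 0 →
      ∃ g : Q.X (n - 1) ⟶ P, Q.d n (n - 1) ≫ g = f) : GClass (cyc Q) := by
  have left : ∀ X ∈ cyc Q, ∃ (n : ℤ) (κ : X ⟶ Q.X (n - 1)) (p : Q.X n ⟶ X), Mono κ ∧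
      p ≫ κ = Q.d n (n - 1) ∧ IsShortExact (kernel.ι (Q.d n (n - 1))) p := by
    rintro X ⟨m, κ, w, hm, hκ⟩
    obtain ⟨n, rfl⟩ : ∃ n, m = n - 1 := ⟨m + 1, by ring⟩
    obtain ⟨p, hp, h⟩ := cyc_se Q hQ n (n - 1) (n - 1 - 1) (by ring) (by ring)
      (kernel.ι (Q.d n (n - 1))) κ (kernel.condition _) w (ShortComplex.exact_kernel _) hκ
    exact ⟨n, κ, p, hm, hp, h⟩
  constructor
  · rintro X ⟨n, ι, w, hm, hι⟩
    obtain ⟨p, hp, h⟩ := cyc_se Q hQ n (n - 1) (n - 1 - 1) (by ring) (by ring)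
      ι (kernel.ι (Q.d (n - 1) (n - 1 - 1))) w (kernel.condition _) hι
      (ShortComplex.exact_kernel _)
    exact ⟨_, _, ι, p, hP n, ⟨n - 1, _, kernel.condition _, inferInstance,
      ShortComplex.exact_kernel _⟩, h⟩
  · intro X hX
    obtain ⟨n, κ, p, hm, hp, h⟩ := left X hX
    exact ⟨_, _, _, p, hP n, ⟨n, _, kernel.condition _, inferInstance,
      ShortComplex.exact_kernel _⟩, h⟩
  · intro X Y Z P i p h hZ hY hPP
    obtain ⟨n, κ, q, hm, hq, h'⟩ := left Z hZ
    have := hP n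
    refine extend_indep h h' fun f => ?_
    obtain ⟨q', hq', h''⟩ := cyc_se Q hQ (n + 1) n (n - 1) rfl (by ring)
      (kernel.ι (Q.d (n + 1) n)) (kernel.ι (Q.d n (n - 1))) (kernel.condition _)
      (kernel.condition _) (ShortComplex.exact_kernel _) (ShortComplex.exact_kernel _)
    have hH' : ∀ (a b : ℤ), b + 1 = a → ∀ f : Q.X a ⟶ P, Q.d (a + 1) a ≫ f = 0 →
        ∃ g : Q.X b ⟶ P, Q.d a b ≫ g = f := by
      intro a b hab
      obtain rfl : b = a - 1 := by omega
      exact hH P hPP a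
    have hz : Q.d (n + 1 + 1) (n + 1) ≫ q' = 0 := by
      rw [← cancel_mono (kernel.ι (Q.d n (n - 1))), Category.assoc, hq']
      simp
    obtain ⟨g, hg⟩ := hH' (n + 1) n rfl (q' ≫ f) (by rw [← Category.assoc, hz, zero_comp])
    have := se_epi h''
    refine ⟨g, ?_⟩
    rw [← cancel_epi q', ← Category.assoc, hq', hg]

lemma gp_gclass : GClass {M : A | IsGorensteinProjective M} := by
  have key : ∀ M : A, IsGorensteinProjective M → ∃ G : Set A, GClass G ∧ M ∈ G := by
    rintro M ⟨Q, hP, hQ, ⟨ι, w, hm, hι⟩, hH⟩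
    exact ⟨cyc Q, cyc_gclass Q hP hQ hH, 0, ι, w, hm, hι⟩
  constructor
  · intro M hM
    obtain ⟨G, hG, hMG⟩ := key M hM
    obtain ⟨P, Y, i, p, hP, hY, h⟩ := hG.right M hMG
    exact ⟨P, Y, i, p, hP, hG.isGP Y hY, h⟩
  · intro M hM
    obtain ⟨G, hG, hMG⟩ := key M hM
    obtain ⟨Y, P, i, p, hP, hY, h⟩ := hG.left M hMG
    exact ⟨Y, P, i, p, hP, hG.isGP Y hY, h⟩
  · intro X Y Z P i p h hZ
    obtain ⟨G, hG, hMG⟩ := key Z hZ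
    exact hG.extend X Y Z P i p h hMG

lemma se_left_zero (X : A) : IsShortExact (0 : (0 : A) ⟶ X) (𝟙 X) :=
  ⟨by simp, ShortComplex.ShortExact.mk' ((ShortComplex.exact_iff_mono _ rfl).2
    (by dsimp; infer_instance)) (by dsimp; infer_instance) (by dsimp; infer_instance)⟩

lemma se_right_zero (X : A) : IsShortExact (𝟙 X) (0 : X ⟶ (0 : A)) :=
  ⟨by simp, ShortComplex.ShortExact.mk' ((ShortComplex.exact_iff_epi _ rfl).2
    (by dsimp; infer_instance)) (by dsimp; infer_instance) (by dsimp; infer_instance)⟩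

lemma proj_gclass : GClass {P : A | Projective P} := by
  constructor
  · intro X hX
    exact ⟨X, 0, 𝟙 X, 0, hX, (inferInstance : Projective (0 : A)), se_right_zero X⟩
  · intro X hX
    exact ⟨0, X, 0, 𝟙 X, hX, (inferInstance : Projective (0 : A)), se_left_zero X⟩
  · intro X Y Z P i p h hZ hY hP f
    have : Projective Z := hZ
    exact extend_indep h (se_left_zero Z) (fun f => ⟨0, by ext⟩) f

section Ext

variable [HasExt.{w} A]

lemma ext_extend {X Y Z T : A} {i : X ⟶ Y} {p : Y ⟶ Z} (hZ : Ext1Zero.{w} Z T)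
    (h : IsShortExact i p) (f : X ⟶ T) : ∃ g, i ≫ g = f := by
  obtain ⟨w', h⟩ := h
  obtain ⟨x, hx⟩ := Abelian.Ext.contravariant_sequence_exact₁ h T (Abelian.Ext.mk₀ f)
    (add_zero 1) (hZ.elim _ _)
  obtain ⟨g, rfl⟩ := (Abelian.Ext.mk₀_bijective _ _).2 x
  refine ⟨g, (Abelian.Ext.mk₀_bijective _ _).1 ?_⟩
  rw [← hx]
  exact (Abelian.Ext.mk₀_comp_mk₀ _ _).symm

lemma ext_lift {K E Z X : A} {i : K ⟶ E} {p : E ⟶ Z} (hX : Ext1Zero.{w} X K)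
    (h : IsShortExact i p) (f : X ⟶ Z) : ∃ g, g ≫ p = f := by
  obtain ⟨w', h⟩ := h
  obtain ⟨x, hx⟩ := Abelian.Ext.covariant_sequence_exact₃ X h (Abelian.Ext.mk₀ f)
    (zero_add 1) (hX.elim _ _)
  obtain ⟨g, rfl⟩ := (Abelian.Ext.mk₀_bijective _ _).2 x
  refine ⟨g, (Abelian.Ext.mk₀_bijective _ _).1 ?_⟩
  rw [← hx]
  exact (Abelian.Ext.mk₀_comp_mk₀ _ _).symm

lemma ext_proj (P T : A) [Projective P] : Ext1Zero.{w} P T :=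
  Abelian.Ext.subsingleton_of_projective P T 0

lemma ext_of_extend {X Y Z T : A} {i : X ⟶ Y} {p : Y ⟶ Z} (h : IsShortExact i p)
    (hY : Projective Y) (H : ∀ f : X ⟶ T, ∃ g, i ≫ g = f) : Ext1Zero.{w} Z T := by
  obtain ⟨w', h⟩ := h
  refine subsingleton_of_forall_eq 0 fun e => ?_
  obtain ⟨x, rfl⟩ := Abelian.Ext.contravariant_sequence_exact₃ h T e
    ((ext_proj Y T).elim _ _) (add_zero 1)
  obtain ⟨f, rfl⟩ := (Abelian.Ext.mk₀_bijective _ _).2 x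
  obtain ⟨g, rfl⟩ := H f
  rw [← Abelian.Ext.mk₀_comp_mk₀]
  exact h.extClass_comp_assoc _

lemma ext_mid {X Y Z T : A} {i : X ⟶ Y} {p : Y ⟶ Z} (h : IsShortExact i p)
    (hX : Ext1Zero.{w} X T) (hZ : Ext1Zero.{w} Z T) : Ext1Zero.{w} Y T := by
  obtain ⟨w', h⟩ := h
  refine subsingleton_of_forall_eq 0 fun e => ?_
  obtain ⟨x, rfl⟩ := Abelian.Ext.contravariant_sequence_exact₂ h T e (hX.elim _ _)
  rw [hZ.elim x 0, Abelian.Ext.comp_zero]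

lemma ext_mid_cov {X Y Z M : A} {i : X ⟶ Y} {p : Y ⟶ Z} (h : IsShortExact i p)
    (hX : Ext1Zero.{w} M X) (hZ : Ext1Zero.{w} M Z) : Ext1Zero.{w} M Y := by
  obtain ⟨w', h⟩ := h
  refine subsingleton_of_forall_eq 0 fun e => ?_
  obtain ⟨x, rfl⟩ := Abelian.Ext.covariant_sequence_exact₂ M h e (hZ.elim _ _)
  rw [hX.elim x 0, Abelian.Ext.zero_comp]

end Ext

end GPAux

theorem gorenstein_projectives_maximal [EnoughProjectives A] [HasExt.{w} A] :
    (∀ C W : Set A, IsProjectiveCotorsionPair.{w} C W →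
      ∀ X ∈ C, IsGorensteinProjective X) ∧
    (IsCompleteCotorsionPair.{w} {M : A | IsGorensteinProjective M}
        {X : A | ∀ M : A, IsGorensteinProjective M → Ext1Zero.{w} M X} →
      IsProjectiveCotorsionPair.{w} {M : A | IsGorensteinProjective M}
        {X : A | ∀ M : A, IsGorensteinProjective M → Ext1Zero.{w} M X}) := by
  constructor
  · rintro C W ⟨⟨⟨hC, hW⟩, hcl, hcr⟩, ⟨hret, h23⟩, hproj⟩
    have hCW : ∀ X ∈ C, ∀ Y ∈ W, Ext1Zero.{w} X Y := fun X hX => (hC X).1 hX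
    refine fun X hX => GPAux.GClass.isGP (G := C) ⟨?_, ?_, ?_⟩ X hX
    · intro X hX
      obtain ⟨V, D, i, p, hV, hD, h⟩ := hcr X
      refine ⟨V, D, i, p, (hproj V).1 ⟨?_, hV⟩, hD, h⟩
      exact (hC V).2 fun Y hY => GPAux.ext_mid h (hCW X hX Y hY) (hCW D hD Y hY)
    · intro X hX
      have h := GPAux.se_kernel (Projective.π X)
      refine ⟨_, _, _, _, inferInstance, ?_, h⟩
      refine (hC _).2 fun Y hY => ?_
      set K := kernel (Projective.π X)
      have hR := GPAux.se_kernel (Projective.π K)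
      refine GPAux.ext_of_extend hR inferInstance fun f => ?_
      obtain ⟨V, D, j, q, hV, hD, hj⟩ := hcr (pushout f (kernel.ι (Projective.π K)))
      have := GPAux.se_mono hj
      let m : Y ⟶ V := pushout.inl _ _ ≫ j
      let r : Projective.over K ⟶ V := pushout.inr _ _ ≫ j
      have hmr : f ≫ m = kernel.ι (Projective.π K) ≫ r := by
        simp only [m, r, ← Category.assoc, pushout.condition]
      have hm := GPAux.se_cokernel m
      have hcm : cokernel m ∈ W := (h23 _ _ hm).1 hY hV
      obtain ⟨t, ht⟩ := GPAux.se_desc hR (r ≫ cokernel.π m) (by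
        rw [← Category.assoc, ← hmr, Category.assoc, cokernel.condition, comp_zero])
      obtain ⟨t', ht'⟩ := GPAux.ext_extend (hCW X hX _ hcm) h t
      let u : Projective.over X ⟶ V := Projective.factorThru t' (cokernel.π m)
      have hu : u ≫ cokernel.π m = t' := Projective.factorThru_comp _ _
      obtain ⟨g, hg⟩ := GPAux.se_lift hm
        (r - Projective.π K ≫ kernel.ι (Projective.π X) ≫ u) (by
          simp only [Preadditive.sub_comp, Category.assoc, hu, ht', ht, sub_self])
      refine ⟨g, ?_⟩
      rw [← cancel_mono m, Category.assoc, hg, hmr]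
      simp
    · intro X Y Z P i p h hZ hY hP f
      exact GPAux.ext_extend (hCW Z hZ P ((hproj P).2 hP).2) h f
  · intro hcomp
    have G := GPAux.gp_gclass (A := A)
    have hGP : ∀ M : A, IsGorensteinProjective M → ∀ P : A, Projective P →
        Ext1Zero.{w} M P := by
      intro M hM P hP
      obtain ⟨Y, R, i, p, hR, hY, h⟩ := G.left M hM
      exact GPAux.ext_of_extend h hR (G.extend _ _ _ P i p h hM hR hP)
    refine ⟨hcomp, ⟨?_, ?_⟩, ?_⟩
    · intro X Y s r hsr hX M hM
      obtain ⟨N, R, i, p, hR, hN, h⟩ := G.left M hM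
      refine GPAux.ext_of_extend h hR fun f => ?_
      obtain ⟨g, hg⟩ := GPAux.ext_extend (hX M hM) h (f ≫ s)
      exact ⟨g ≫ r, by rw [← Category.assoc, hg, Category.assoc, hsr, Category.comp_id]⟩
    · intro X Y Z a b hab
      refine ⟨fun hX hY M hM => ?_, fun hX hZ M hM => ?_, fun hY hZ M hM => ?_⟩
      · obtain ⟨N, R, i, p, hR, hN, h⟩ := G.left M hM
        refine GPAux.ext_of_extend h hR fun f => ?_
        obtain ⟨g, hg⟩ := GPAux.ext_lift (hX N hN) hab f
        obtain ⟨k, hk⟩ := GPAux.ext_extend (hY M hM) h g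
        exact ⟨k ≫ b, by rw [← Category.assoc, hk, hg]⟩
      · exact GPAux.ext_mid_cov hab (hX M hM) (hZ M hM)
      · obtain ⟨N, R, i, p, hR, hN, h⟩ := G.left M hM
        refine GPAux.ext_of_extend h hR fun f => ?_
        have := GPAux.se_mono hab
        have := GPAux.se_epi hab
        obtain ⟨g, hg⟩ := GPAux.ext_extend (hY M hM) h (f ≫ a)
        obtain ⟨t, ht⟩ := GPAux.se_desc h (g ≫ b) (by
          rw [← Category.assoc, hg, Category.assoc, GPAux.se_zero hab, comp_zero])
        obtain ⟨R', M', i', p', hR', hM', h'⟩ := G.right M hM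
        obtain ⟨t', ht'⟩ := GPAux.ext_extend (hZ M' hM') h' t
        let u : R' ⟶ Y := Projective.factorThru t' b
        have hu : u ≫ b = t' := Projective.factorThru_comp _ _
        obtain ⟨k, hk⟩ := GPAux.se_lift hab (g - p ≫ i' ≫ u) (by
          simp only [Preadditive.sub_comp, Category.assoc, hu, ht', ht, sub_self])
        refine ⟨k, ?_⟩
        have hz := GPAux.se_zero h
        rw [← cancel_mono a, Category.assoc, hk, Preadditive.comp_sub, hg, ← Category.assoc i,
          hz, zero_comp, sub_zero]
    · intro X
      constructor
      · rintro ⟨hX, hX'⟩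
        obtain ⟨R, Y, i, p, hR, hY, h⟩ := G.right X hX
        obtain ⟨r, hr⟩ := GPAux.ext_extend (hX' Y hY) h (𝟙 X)
        exact Retract.projective ⟨i, r, hr⟩
      · intro hX
        exact ⟨GPAux.proj_gclass.isGP X hX, fun M hM => hGP M hM X hX⟩
end
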